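/- arXiv:1311.0113 — 9 statements merged into one kernel-verified Lean document; each statement's English description precedes it below -/
import Mathlib

section
/- Let Γ be a nonempty proper subset of the set of k-element subsets of 𝒱, where 2 ≤ k ≤ v−2, and let G ≤ Sym(𝒱) leave Γ invariant. Then Γ is G-strongly incidence-transitive if and only if Γ is G-incidence-transitive and δ(Γ) ≥ 2. -/
variable {α : Type*} [DecidableEq α]

/-- The image of a finset under a permutation. -/
def pact (g : Equiv.Perm α) (s : Finset α) : Finset α := s.image g

/-- Adjacency in the Johnson graph `J(v,k)`: two `k`-subsets meeting in `k-1` points. -/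
def JAdj (k : ℕ) (s t : Finset α) : Prop := s ≠ t ∧ (s ∩ t).card = k - 1

/-- The neighbour set `Γ₁` of a code `Γ` of `k`-subsets: the `k`-subsets not in `Γ`
adjacent to at least one member of `Γ`. -/
def nbrSet (k : ℕ) (Γ : Set (Finset α)) : Set (Finset α) :=
  {β | β.card = k ∧ β ∉ Γ ∧ ∃ γ ∈ Γ, JAdj k γ β}

/-- `G` leaves `Γ` invariant. -/
def Invariant (G : Set (Equiv.Perm α)) (Γ : Set (Finset α)) : Prop :=
  ∀ g ∈ G, ∀ γ ∈ Γ, pact g γ ∈ Γ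

/-- `G` is transitive on the collection `Γ` of finsets. -/
def TransOn (G : Set (Equiv.Perm α)) (Γ : Set (Finset α)) : Prop :=
  ∀ γ ∈ Γ, ∀ γ' ∈ Γ, ∃ g ∈ G, pact g γ = γ'

/-- `G` is transitive on the points. -/
def TransOnPts (G : Set (Equiv.Perm α)) : Prop := ∀ x y : α, ∃ g ∈ G, g x = y

/-- `Γ` is `G`-neighbour-transitive: `G` is transitive on `Γ` and on its neighbour set. -/
def NbrTrans (G : Set (Equiv.Perm α)) (k : ℕ) (Γ : Set (Finset α)) : Prop :=
  TransOn G Γ ∧ TransOn G (nbrSet k Γ)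

/-- `Γ` is `G`-incidence-transitive: `G` is transitive on adjacent pairs
`(γ, γ₁) ∈ Γ × Γ₁`. -/
def IncTrans (G : Set (Equiv.Perm α)) (k : ℕ) (Γ : Set (Finset α)) : Prop :=
  ∀ γ ∈ Γ, ∀ γ₁ ∈ nbrSet k Γ, JAdj k γ γ₁ →
    ∀ γ' ∈ Γ, ∀ γ₁' ∈ nbrSet k Γ, JAdj k γ' γ₁' →
      ∃ g ∈ G, pact g γ = γ' ∧ pact g γ₁ = γ₁'

/-- `Γ` is `G`-strongly incidence-transitive: `G` is transitive on `Γ` and, for each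
`γ ∈ Γ`, the setwise stabiliser of `γ` is transitive on `γ × (𝒱 ∖ γ)`. -/
def StrIncTrans (G : Set (Equiv.Perm α)) (Γ : Set (Finset α)) : Prop :=
  TransOn G Γ ∧
  ∀ γ ∈ Γ, ∀ u ∈ γ, ∀ w ∉ γ, ∀ u' ∈ γ, ∀ w' ∉ γ,
    ∃ g ∈ G, pact g γ = γ ∧ g u = u' ∧ g w = w'

/-- The minimum (Johnson) distance of `Γ` is at least `d`. -/
def MinDistGE (d : ℕ) (Γ : Set (Finset α)) : Prop :=
  ∀ s ∈ Γ, ∀ t ∈ Γ, s ≠ t → d ≤ s.card - (s ∩ t).card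

/-- The minimum (Johnson) distance of a code `Γ`. -/
noncomputable def minDist (Γ : Set (Finset α)) : ℕ :=
  sInf {d | ∃ s ∈ Γ, ∃ t ∈ Γ, s ≠ t ∧ d = s.card - (s ∩ t).card}

/-- Swap `u` for `w`. -/
def swp (s : Finset α) (u w : α) : Finset α := insert w (s.erase u)

theorem swp_card {s : Finset α} {u w : α} (hu : u ∈ s) (hw : w ∉ s) :
    (swp s u w).card = s.card := by
  have h0 : 0 < s.card := Finset.card_pos.2 ⟨u, hu⟩
  rw [swp, Finset.card_insert_of_notMem (fun h => hw (Finset.mem_of_mem_erase h)),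
    Finset.card_erase_of_mem hu]
  omega

theorem inter_swp {s : Finset α} {u w : α} (hw : w ∉ s) :
    s ∩ swp s u w = s.erase u := by
  ext x
  simp only [swp, Finset.mem_inter, Finset.mem_insert, Finset.mem_erase]
  constructor
  · rintro ⟨hx, rfl | h⟩
    · exact absurd hx hw
    · exact h
  · rintro ⟨h1, h2⟩
    exact ⟨h2, Or.inr ⟨h1, h2⟩⟩

theorem swp_ne {s : Finset α} {u w : α} (hw : w ∉ s) : s ≠ swp s u w := by
  intro h
  exact hw (h ▸ Finset.mem_insert_self w (s.erase u))

theorem jadj_swp {s : Finset α} {u w : α} (hu : u ∈ s) (hw : w ∉ s) :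
    JAdj s.card s (swp s u w) :=
  ⟨swp_ne hw, by rw [inter_swp hw, Finset.card_erase_of_mem hu]⟩

theorem exists_swp {s t : Finset α} (hc : t.card = s.card) (h0 : 0 < s.card)
    (hi : (s ∩ t).card = s.card - 1) : ∃ u ∈ s, ∃ w, w ∉ s ∧ t = swp s u w := by
  have h1 : (s \ t).card = 1 := by
    have := Finset.card_sdiff_add_card_inter s t
    omega
  have h2 : (t \ s).card = 1 := by
    have := Finset.card_sdiff_add_card_inter t s
    rw [Finset.inter_comm] at this
    omega
  obtain ⟨u, hu⟩ := Finset.card_eq_one.1 h1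
  obtain ⟨w, hw⟩ := Finset.card_eq_one.1 h2
  have hu' : ∀ x, (x ∈ s ∧ x ∉ t) ↔ x = u := fun x => by
    rw [← Finset.mem_sdiff, hu, Finset.mem_singleton]
  have hw' : ∀ x, (x ∈ t ∧ x ∉ s) ↔ x = w := fun x => by
    rw [← Finset.mem_sdiff, hw, Finset.mem_singleton]
  refine ⟨u, ((hu' u).2 rfl).1, w, ((hw' w).2 rfl).2, ?_⟩
  ext x
  have a := hu' x
  have b := hw' x
  simp only [swp, Finset.mem_insert, Finset.mem_erase]
  tauto

theorem pact_swp (g : Equiv.Perm α) (s : Finset α) (u w : α) :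
    pact g (swp s u w) = swp (pact g s) (g u) (g w) := by
  simp [pact, swp, Finset.image_insert, Finset.image_erase g.injective]

theorem mem_pact (g : Equiv.Perm α) {s : Finset α} {x : α} : g x ∈ pact g s ↔ x ∈ s := by
  simp [pact]

theorem pact_mul (g h : Equiv.Perm α) (s : Finset α) : pact (g * h) s = pact g (pact h s) := by
  simp [pact, Finset.image_image, Equiv.Perm.coe_mul]

theorem swp_inj {s : Finset α} {u w u' w' : α} (hu : u ∈ s) (hw : w ∉ s) (hw' : w' ∉ s)
    (h : swp s u w = swp s u' w') : u = u' ∧ w = w' := by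
  have a := Finset.ext_iff.1 h u
  have b := Finset.ext_iff.1 h w
  simp only [swp, Finset.mem_insert, Finset.mem_erase] at a b
  have : u ≠ w := fun e => hw (e ▸ hu)
  have : u ≠ w' := fun e => hw' (e ▸ hu)
  tauto

theorem all_mem {k : ℕ} {Γ : Set (Finset α)} (hc : ∀ γ ∈ Γ, γ.card = k)
    (hcl : ∀ γ ∈ Γ, ∀ u ∈ γ, ∀ w ∉ γ, swp γ u w ∈ Γ) (t : Finset α) (ht : t.card = k) :
    ∀ n : ℕ, ∀ γ ∈ Γ, (γ \ t).card = n → t ∈ Γ := by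
  intro n
  induction n with
  | zero =>
    intro γ hγ h
    have hs : γ ⊆ t := Finset.sdiff_eq_empty_iff_subset.1 (Finset.card_eq_zero.1 h)
    have : γ = t := Finset.eq_of_subset_of_card_le hs (by rw [ht, hc γ hγ])
    exact this ▸ hγ
  | succ n ih =>
    intro γ hγ h
    obtain ⟨u, hu⟩ := Finset.card_pos.1 (show 0 < (γ \ t).card by omega)
    have h2 : 0 < (t \ γ).card := by
      have e1 := Finset.card_sdiff_add_card_inter γ t
      have e2 := Finset.card_sdiff_add_card_inter t γ
      rw [Finset.inter_comm] at e2
      have := hc γ hγ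
      omega
    obtain ⟨w, hw⟩ := Finset.card_pos.1 h2
    have hu' := Finset.mem_sdiff.1 hu
    have hw' := Finset.mem_sdiff.1 hw
    refine ih (swp γ u w) (hcl γ hγ u hu'.1 w hw'.2) ?_
    have : swp γ u w \ t = (γ \ t).erase u := by
      rw [swp, Finset.insert_sdiff_of_mem _ hw'.1, Finset.erase_sdiff_comm]
    rw [this, Finset.card_erase_of_mem hu, h]
    rfl

/-- Theorem `flagtra`(a): for a nonempty proper code `Γ` of `k`-subsets
of `𝒱`, `2 ≤ k ≤ v-2`, invariant under `G ≤ Sym(𝒱)`, the code `Γ` is `G`-strongly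
incidence-transitive iff it is `G`-incidence-transitive with minimum distance at least 2. -/
theorem stmt0 {V : Type*} [Fintype V] [DecidableEq V] (k : ℕ)
    (hk : 2 ≤ k) (hk' : k ≤ Fintype.card V - 2)
    (Γ : Set (Finset V)) (hΓcard : ∀ γ ∈ Γ, γ.card = k)
    (hne : Γ.Nonempty) (hproper : Γ ≠ {s : Finset V | s.card = k})
    (G : Subgroup (Equiv.Perm V)) (hinv : Invariant (G : Set (Equiv.Perm V)) Γ) :
    StrIncTrans (G : Set (Equiv.Perm V)) Γ ↔
      IncTrans (G : Set (Equiv.Perm V)) k Γ ∧ MinDistGE 2 Γ := by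
  constructor
  · rintro ⟨hT, hS⟩
    have hD : MinDistGE 2 Γ := by
      intro s hs t ht hst
      by_contra hlt
      apply hproper
      have cs := hΓcard s hs
      have ct := hΓcard t ht
      have hnot : (s ∩ t).card ≠ s.card := by
        intro h
        have h1 : s ∩ t = s := Finset.eq_of_subset_of_card_le Finset.inter_subset_left h.ge
        have h2 : s ⊆ t := Finset.inter_eq_left.1 h1
        exact hst (Finset.eq_of_subset_of_card_le h2 (by omega))
      have hle : (s ∩ t).card ≤ s.card := Finset.card_le_card Finset.inter_subset_left
      obtain ⟨u, hu, w, hw, rfl⟩ := exists_swp (s := s) (t := t) (by omega) (by omega) (by omega)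
      have hcl : ∀ γ ∈ Γ, ∀ u' ∈ γ, ∀ w' ∉ γ, swp γ u' w' ∈ Γ := by
        intro γ hγ u' hu' w' hw'
        obtain ⟨g, hg, rfl⟩ := hT s hs γ hγ
        obtain ⟨g', hg', e1, e2, e3⟩ := hS _ hγ (g u) ((mem_pact g).2 hu) (g w)
          (fun h => hw ((mem_pact g).1 h)) u' hu' w' hw'
        have := hinv g' hg' _ (hinv g hg _ ht)
        rwa [pact_swp, pact_swp, e1, e2, e3] at this
      ext t
      exact ⟨fun h => hΓcard t h, fun h => all_mem hΓcard hcl t h _ s hs rfl⟩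
    refine ⟨?_, hD⟩
    intro γ hγ γ₁ h₁ ha γ' hγ' γ₁' h₁' ha'
    have c := hΓcard γ hγ
    have c' := hΓcard γ' hγ'
    obtain ⟨u, hu, w, hw, rfl⟩ := exists_swp (h₁.1.trans c.symm) (by omega) (c ▸ ha.2)
    obtain ⟨u', hu', w', hw', rfl⟩ := exists_swp (h₁'.1.trans c'.symm) (by omega) (c' ▸ ha'.2)
    obtain ⟨g, hg, rfl⟩ := hT γ hγ γ' hγ'
    obtain ⟨g', hg', e1, e2, e3⟩ := hS _ hγ' (g u) ((mem_pact g).2 hu) (g w)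
      (fun h => hw ((mem_pact g).1 h)) u' hu' w' hw'
    refine ⟨g' * g, G.mul_mem hg' hg, ?_, ?_⟩
    · rw [pact_mul, e1]
    · rw [pact_mul, pact_swp, pact_swp, e1, e2, e3]
  · rintro ⟨hI, hD⟩
    have key : ∀ γ ∈ Γ, ∀ u ∈ γ, ∀ w ∉ γ,
        swp γ u w ∈ nbrSet k Γ ∧ JAdj k γ (swp γ u w) := by
      intro γ hγ u hu w hw
      have c := hΓcard γ hγ
      have hj : JAdj k γ (swp γ u w) := c ▸ jadj_swp hu hw
      refine ⟨⟨(swp_card hu hw).trans c, fun h => ?_, γ, hγ, hj⟩, hj⟩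
      have := hD _ hγ _ h (swp_ne hw)
      rw [hj.2] at this
      omega
    have ex : ∀ γ ∈ Γ, ∃ u ∈ γ, ∃ w, w ∉ γ := by
      intro γ hγ
      have c := hΓcard γ hγ
      obtain ⟨u, hu⟩ := Finset.card_pos.1 (show 0 < γ.card by omega)
      refine ⟨u, hu, ?_⟩
      by_contra! h
      have : γ = Finset.univ := Finset.eq_univ_iff_forall.2 h
      rw [this, Finset.card_univ] at c
      omega
    constructor
    · intro γ hγ γ' hγ'
      obtain ⟨u, hu, w, hw⟩ := ex γ hγ
      obtain ⟨u', hu', w', hw'⟩ := ex γ' hγ'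
      obtain ⟨a, b⟩ := key γ hγ u hu w hw
      obtain ⟨a', b'⟩ := key γ' hγ' u' hu' w' hw'
      obtain ⟨g, hg, e, -⟩ := hI γ hγ _ a b γ' hγ' _ a' b'
      exact ⟨g, hg, e⟩
    · intro γ hγ u hu w hw u' hu' w' hw'
      obtain ⟨a, b⟩ := key γ hγ u hu w hw
      obtain ⟨a', b'⟩ := key γ hγ u' hu' w' hw'
      obtain ⟨g, hg, e, e'⟩ := hI γ hγ _ a b γ hγ _ a' b'
      refine ⟨g, hg, e, ?_⟩
      rw [pact_swp, e] at e'
      have m1 : g u ∈ γ := e ▸ (mem_pact g).2 hu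
      have m2 : g w ∉ γ := fun h => hw ((mem_pact g).1 (e.symm ▸ h))
      exact swp_inj m1 m2 hw' e'
end

section
/- Let Γ be a nonempty proper subset of the set of k-element subsets of 𝒱, where 2 ≤ k ≤ v−2, and let G ≤ Sym(𝒱) leave Γ invariant. If δ(Γ) ≥ 3 and Γ is G-neighbour-transitive, then Γ is G-strongly incidence-transitive. -/
variable {α : Type*} [DecidableEq α]

/-- Theorem `flagtra`(b): for a nonempty proper code `Γ` of `k`-subsets
of `𝒱`, `2 ≤ k ≤ v-2`, invariant under `G ≤ Sym(𝒱)`, if `δ(Γ) ≥ 3` and `Γ` is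
`G`-neighbour-transitive then `Γ` is `G`-strongly incidence-transitive. -/
theorem stmt1 {V : Type*} [Fintype V] [DecidableEq V] (k : ℕ)
    (hk : 2 ≤ k) (hk' : k ≤ Fintype.card V - 2)
    (Γ : Set (Finset V)) (hΓcard : ∀ γ ∈ Γ, γ.card = k)
    (hne : Γ.Nonempty) (hproper : Γ ≠ {s : Finset V | s.card = k})
    (G : Subgroup (Equiv.Perm V)) (hinv : Invariant (G : Set (Equiv.Perm V)) Γ)
    (hδ : MinDistGE 3 Γ) (hnt : NbrTrans (G : Set (Equiv.Perm V)) k Γ) :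
    StrIncTrans (G : Set (Equiv.Perm V)) Γ := by
  refine ⟨hnt.1, ?_⟩
  intro γ hγ u hu w hw u' hu' w' hw'
  have hc := hΓcard γ hγ
  have key : ∀ a ∈ γ, ∀ b ∉ γ, (γ ∩ insert b (γ.erase a)).card = k - 1 ∧
      (insert b (γ.erase a)).card = k ∧ insert b (γ.erase a) ∈ nbrSet k Γ := by
    intro a ha b hb
    have h0 : γ ∩ insert b (γ.erase a) = γ.erase a := by
      ext x
      simp only [Finset.mem_inter, Finset.mem_insert, Finset.mem_erase]
      grind
    have h1 : (γ ∩ insert b (γ.erase a)).card = k - 1 := by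
      rw [h0, Finset.card_erase_of_mem ha, hc]
    have h2 : (insert b (γ.erase a)).card = k := by
      rw [Finset.card_insert_of_notMem (by simp [hb]), Finset.card_erase_of_mem ha, hc]
      omega
    have h3 : γ ≠ insert b (γ.erase a) := by
      intro h
      exact hb (h ▸ Finset.mem_insert_self b _)
    refine ⟨h1, h2, h2, ?_, γ, hγ, h3, h1⟩
    intro hmem
    have := hδ γ hγ _ hmem h3
    omega
  obtain ⟨k1, k2, k3⟩ := key u hu w hw
  obtain ⟨k1', k2', k3'⟩ := key u' hu' w' hw'
  obtain ⟨g, hg, hgb⟩ := hnt.2 _ k3 _ k3'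
  have hgγ : pact g γ ∈ Γ := hinv g hg γ hγ
  have hi : (pact g γ ∩ insert w' (γ.erase u')).card = k - 1 := by
    rw [← hgb, pact, pact, ← Finset.image_inter _ _ g.injective,
      Finset.card_image_of_injective _ g.injective, k1]
  have hfix : pact g γ = γ := by
    by_contra hcon
    have h3 := hδ γ hγ _ hgγ (Ne.symm hcon)
    have hun := Finset.card_union_add_card_inter (γ ∩ insert w' (γ.erase u'))
      (pact g γ ∩ insert w' (γ.erase u'))
    have hle : ((γ ∩ insert w' (γ.erase u')) ∪ (pact g γ ∩ insert w' (γ.erase u'))).card ≤ k := by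
      rw [← k2']
      apply Finset.card_le_card
      intro x
      simp only [Finset.mem_union, Finset.mem_inter]
      tauto
    have hle2 : ((γ ∩ insert w' (γ.erase u')) ∩ (pact g γ ∩ insert w' (γ.erase u'))).card
        ≤ (γ ∩ pact g γ).card := by
      apply Finset.card_le_card
      intro x
      simp only [Finset.mem_inter]
      tauto
    omega
  have m1 : ∀ x, g x ∈ γ ↔ x ∈ γ := by
    intro x
    conv_lhs => rw [← hfix]
    simp [pact]
  have m2 : ∀ x, g x ∈ insert w' (γ.erase u') ↔ x ∈ insert w (γ.erase u) := by
    intro x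
    rw [← hgb]
    simp only [pact, Finset.mem_image, EmbeddingLike.apply_eq_iff_eq, exists_eq_right]
  refine ⟨g, hg, hfix, ?_, ?_⟩
  · have a := m1 u
    have b := m2 u
    simp only [Finset.mem_insert, Finset.mem_erase] at b
    grind
  · have a := m1 w
    have b := m2 w
    simp only [Finset.mem_insert, Finset.mem_erase] at b
    grind
end

section
/- Let Γ be a nonempty proper subset of the set of k-element subsets of 𝒱, where 2 ≤ k ≤ v−2, and let G ≤ Sym(𝒱) leave Γ invariant. If G acts primitively on 𝒱 (G is transitive on 𝒱 and the only G-invariant partitions of 𝒱 are the partition into singletons and the partition with the single part 𝒱) and Γ is G-strongly incidence-transitive, then G is 2-transitive on 𝒱, i.e. G is transitive on ordered pairs of distinct elements of 𝒱. -/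
variable {α : Type*} [DecidableEq α]

/-- `G` acts primitively on the points: it is transitive, and every `G`-invariant
equivalence relation on the points is trivial (equality or the universal relation). -/
def Primitive (G : Set (Equiv.Perm α)) : Prop :=
  TransOnPts G ∧
  ∀ r : Setoid α, (∀ g ∈ G, ∀ x y : α, r.r x y → r.r (g x) (g y)) →
    (∀ x y : α, r.r x y → x = y) ∨ (∀ x y : α, r.r x y)

/-- `G` is 2-transitive on the points. -/
def TwoTrans (G : Set (Equiv.Perm α)) : Prop :=
  ∀ x y x' y' : α, x ≠ y → x' ≠ y' → ∃ g ∈ G, g x = x' ∧ g y = y'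

/-- Theorem `flagtra`(c): for a nonempty proper code `Γ` of `k`-subsets
of `𝒱`, `2 ≤ k ≤ v-2`, invariant under `G ≤ Sym(𝒱)`, if `G` is primitive on `𝒱` and `Γ`
is `G`-strongly incidence-transitive, then `G` is 2-transitive on `𝒱`. -/
theorem stmt2 {V : Type*} [Fintype V] [DecidableEq V] (k : ℕ)
    (hk : 2 ≤ k) (hk' : k ≤ Fintype.card V - 2)
    (Γ : Set (Finset V)) (hΓcard : ∀ γ ∈ Γ, γ.card = k)
    (hne : Γ.Nonempty) (hproper : Γ ≠ {s : Finset V | s.card = k})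
    (G : Subgroup (Equiv.Perm V)) (hinv : Invariant (G : Set (Equiv.Perm V)) Γ)
    (hprim : Primitive (G : Set (Equiv.Perm V)))
    (hstr : StrIncTrans (G : Set (Equiv.Perm V)) Γ) :
    TwoTrans (G : Set (Equiv.Perm V)) := by
  classical
  obtain ⟨htr, hst⟩ := hstr
  obtain ⟨htp, hpr⟩ := hprim
  have mem_pact : ∀ (g : Equiv.Perm V) (s : Finset V) (x : V), g x ∈ pact g s ↔ x ∈ s := by
    intro g s x
    simp [pact]
  have mem_pact_inv : ∀ (g : Equiv.Perm V) (s : Finset V) (x : V),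
      x ∈ pact g⁻¹ s ↔ g x ∈ s := by
    intro g s x
    have h := mem_pact g⁻¹ s (g x)
    simpa using h
  let S : V → Finset (Finset V) := fun x => Finset.univ.filter (fun γ => γ ∈ Γ ∧ x ∈ γ)
  have memS : ∀ x γ, γ ∈ S x ↔ γ ∈ Γ ∧ x ∈ γ := by
    intro x γ
    simp [S]
  have hcard : ∀ x y, (S x).card ≤ (S y).card := by
    intro x y
    obtain ⟨g, hg, rfl⟩ := htp x y
    refine Finset.card_le_card_of_injOn (pact g) ?_ ?_
    · intro γ hγ
      have hγ' := (memS x γ).1 hγ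
      exact (memS _ _).2 ⟨hinv g hg γ hγ'.1, (mem_pact g γ x).2 hγ'.2⟩
    · intro a _ b _ h
      exact Finset.image_injective g.injective h
  have hS : ∀ x y, S x = S y → x = y := by
    let r : Setoid V := ⟨fun x y => S x = S y, ⟨fun _ => rfl, fun h => h.symm,
      fun h h' => h.trans h'⟩⟩
    rcases hpr r (by
      intro g hg x y hxy
      change S x = S y at hxy
      change S (g x) = S (g y)
      ext γ
      have key : ∀ z, γ ∈ S (g z) ↔ γ ∈ Γ ∧ pact g⁻¹ γ ∈ S z := by
        intro z
        rw [memS, memS, mem_pact_inv]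
        constructor
        · rintro ⟨h1, h2⟩
          exact ⟨h1, hinv _ (G.inv_mem hg) _ h1, h2⟩
        · rintro ⟨h1, _, h2⟩
          exact ⟨h1, h2⟩
      rw [key, key, hxy]) with h | h
    · exact h
    · exfalso
      obtain ⟨γ, hγ⟩ := hne
      have hc := hΓcard γ hγ
      obtain ⟨x, hx⟩ : γ.Nonempty := by
        rw [← Finset.card_pos]; omega
      obtain ⟨y, hy⟩ : ∃ y, y ∉ γ := by
        by_contra! hcon
        have : γ = Finset.univ := Finset.eq_univ_iff_forall.2 hcon
        rw [this, Finset.card_univ] at hc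
        omega
      have hxy : S x = S y := h x y
      have h1 : γ ∈ S x := (memS _ _).2 ⟨hγ, hx⟩
      rw [hxy] at h1
      exact hy ((memS _ _).1 h1).2
  have sep : ∀ x y, x ≠ y → ∃ γ ∈ Γ, x ∈ γ ∧ y ∉ γ := by
    intro x y hxy
    by_contra! hcon
    refine hxy (hS x y (Finset.eq_of_subset_of_card_le ?_ (hcard y x)))
    intro γ hγ
    have h := (memS _ _).1 hγ
    exact (memS _ _).2 ⟨h.1, hcon γ h.1 h.2⟩
  intro x y x' y' hxy hxy'
  obtain ⟨γ, hγ, hx, hy⟩ := sep x y hxy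
  obtain ⟨γ', hγ', hx', hy'⟩ := sep x' y' hxy'
  obtain ⟨g, hg, rfl⟩ := htr γ hγ γ' hγ'
  obtain ⟨h, hh, _, h1, h2⟩ := hst _ hγ' (g x) ((mem_pact g γ x).2 hx) (g y)
    (fun hc => hy ((mem_pact g γ y).1 hc)) x' hx' y' hy'
  exact ⟨h * g, G.mul_mem hh hg, h1, h2⟩
end

section
/- Suppose 2 ≤ k ≤ v−2, Γ is a nonempty proper subset of the set of k-element subsets of 𝒱, G ≤ Sym(𝒱) leaves Γ invariant, Γ is G-neighbour-transitive, and G is intransitive on 𝒱. Then there exists a nonempty proper subset U of 𝒱 such that either Γ is the set of all k-element subsets of 𝒱 contained in U, or Γ is the set of all k-element subsets of 𝒱 containing U. -/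
variable {α : Type*} [DecidableEq α]

theorem aux_swap_card {V : Type*} [DecidableEq V] (s : Finset V) {u w : V}
    (hu : u ∈ s) (hw : w ∉ s) : (insert w (s.erase u)).card = s.card := by
  rw [Finset.card_insert_of_notMem (by simp [hw]), Finset.card_erase_add_one hu]

theorem aux_swap_mem {V : Type*} [DecidableEq V] (k : ℕ) (Γ : Set (Finset V))
    (hΓcard : ∀ γ ∈ Γ, γ.card = k) {s : Finset V} (hs : s ∈ Γ) {u w : V}
    (hu : u ∈ s) (hw : w ∉ s) :
    insert w (s.erase u) ∈ Γ ∨ insert w (s.erase u) ∈ nbrSet k Γ := by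
  by_cases h : insert w (s.erase u) ∈ Γ
  · exact Or.inl h
  · refine Or.inr ⟨by rw [aux_swap_card s hu hw, hΓcard s hs], h, s, hs, ?_, ?_⟩
    · intro e
      apply hw
      rw [e]
      simp
    · have : s ∩ insert w (s.erase u) = s.erase u := by
        ext z
        simp only [Finset.mem_inter, Finset.mem_insert, Finset.mem_erase]
        constructor
        · rintro ⟨h1, h2 | h2⟩
          · subst h2; exact absurd h1 hw
          · exact h2
        · intro h2; exact ⟨h2.2, Or.inr h2⟩
      rw [this, Finset.card_erase_of_mem hu, hΓcard s hs]

theorem aux_swap_inter {V : Type*} [DecidableEq V] (s W : Finset V) {u w : V}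
    (hu : u ∈ s) (hw : w ∉ s) :
    (insert w (s.erase u) ∩ W).card + (if u ∈ W then 1 else 0)
      = (s ∩ W).card + (if w ∈ W then 1 else 0) := by
  have h1 : (s.erase u ∩ W).card + (if u ∈ W then 1 else 0) = (s ∩ W).card := by
    rw [Finset.erase_inter]
    split_ifs with h
    · exact Finset.card_erase_add_one (by simp [hu, h])
    · rw [Finset.erase_eq_of_notMem (by simp [h])]; rfl
  have h2 : (insert w (s.erase u) ∩ W).card
      = (s.erase u ∩ W).card + (if w ∈ W then 1 else 0) := by
    split_ifs with h
    · rw [Finset.insert_inter_of_mem h, Finset.card_insert_of_notMem (by simp [hw])]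
    · rw [Finset.insert_inter_of_notMem h]; rfl
  omega

/-- Two distinct sets with equal profile can be brought closer by a swap on one side. -/
theorem aux_exists_swap {V : Type*} [DecidableEq V] (s t W : Finset V)
    (hc : s.card = t.card) (hW : (s ∩ W).card = (t ∩ W).card) (hne : s ≠ t) :
    ∃ u w, u ∈ s ∧ u ∉ t ∧ w ∉ s ∧ w ∈ t ∧ (u ∈ W ↔ w ∈ W) := by
  have key : ∀ A B : Finset V, A.card = B.card → A ≠ B →
      (∃ u, u ∈ A ∧ u ∉ B) ∧ ∃ w, w ∈ B ∧ w ∉ A := by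
    intro A B h hAB
    constructor
    · by_contra hcon
      push Not at hcon
      exact hAB (Finset.eq_of_subset_of_card_le hcon h.ge)
    · by_contra hcon
      push Not at hcon
      exact hAB (Finset.eq_of_subset_of_card_le hcon h.le).symm
  by_cases h : s ∩ W = t ∩ W
  · obtain ⟨⟨u, hu, hu'⟩, w, hw, hw'⟩ := key s t hc hne
    have e1 := Finset.ext_iff.1 h u
    have e2 := Finset.ext_iff.1 h w
    simp only [Finset.mem_inter] at e1 e2
    exact ⟨u, w, hu, hu', hw', hw, by tauto⟩
  · obtain ⟨⟨u, hu, hu'⟩, w, hw, hw'⟩ := key _ _ hW h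
    simp only [Finset.mem_inter] at hu hu' hw hw'
    exact ⟨u, w, hu.1, by tauto, by tauto, hw.1, by tauto⟩

theorem aux_conn {V : Type*} [DecidableEq V] (k : ℕ) (Γ : Set (Finset V))
    (hΓcard : ∀ γ ∈ Γ, γ.card = k) (W : Finset V) (a : ℕ)
    (hb : ∀ β ∈ nbrSet k Γ, (β ∩ W).card ≠ a) (t : Finset V) (ht : t.card = k)
    (hta : (t ∩ W).card = a) :
    ∀ n, ∀ s ∈ Γ, (s ∩ W).card = a → (s \ t).card = n → t ∈ Γ := by
  intro n
  induction n with
  | zero =>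
    intro s hs _ h0
    have : s ⊆ t := by
      rw [Finset.card_eq_zero] at h0
      exact Finset.sdiff_eq_empty_iff_subset.1 h0
    rw [← Finset.eq_of_subset_of_card_le this (by rw [ht, hΓcard s hs])]
    exact hs
  | succ n ih =>
    intro s hs hsa hn
    have hne : s ≠ t := by
      rintro rfl
      simp at hn
    obtain ⟨u, w, hu, hu', hw, hw', huw⟩ :=
      aux_exists_swap s t W (by rw [hΓcard s hs, ht]) (by rw [hsa, hta]) hne
    have hi := aux_swap_inter s W hu hw
    have hca : (insert w (s.erase u) ∩ W).card = a := by
      simp only [huw] at hi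
      omega
    rcases aux_swap_mem k Γ hΓcard hs hu hw with h | h
    · refine ih _ h hca ?_
      rw [Finset.insert_sdiff_of_mem _ hw', Finset.erase_sdiff_comm,
        Finset.card_erase_of_mem (by simp [hu, hu']), hn]
      rfl
    · exact absurd hca (hb _ h)

theorem aux_pact {V : Type*} [DecidableEq V] (g : Equiv.Perm V) (s W : Finset V)
    (h : ∀ z, g z ∈ W ↔ z ∈ W) : (pact g s ∩ W).card = (s ∩ W).card := by
  have : pact g s ∩ W = (s ∩ W).image g := by
    ext z
    simp only [pact, Finset.mem_inter, Finset.mem_image]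
    constructor
    · rintro ⟨⟨y, hy, rfl⟩, hz⟩
      exact ⟨y, ⟨hy, (h y).1 hz⟩, rfl⟩
    · rintro ⟨y, ⟨hy, hz⟩, rfl⟩
      exact ⟨⟨y, hy, rfl⟩, (h y).2 hz⟩
  rw [this, Finset.card_image_of_injective _ g.injective]

/-- Proposition `intrans`: a neighbour-transitive code whose group is
intransitive on the points consists of all `k`-subsets of some proper nonempty subset
`U`, or of all `k`-subsets containing `U`. -/
theorem stmt4 {V : Type*} [Fintype V] [DecidableEq V] (k : ℕ)
    (hk : 2 ≤ k) (hk' : k ≤ Fintype.card V - 2)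
    (Γ : Set (Finset V)) (hΓcard : ∀ γ ∈ Γ, γ.card = k)
    (hne : Γ.Nonempty) (hproper : Γ ≠ {s : Finset V | s.card = k})
    (G : Subgroup (Equiv.Perm V)) (hinv : Invariant (G : Set (Equiv.Perm V)) Γ)
    (hnt : NbrTrans (G : Set (Equiv.Perm V)) k Γ)
    (hintrans : ¬ TransOnPts (G : Set (Equiv.Perm V))) :
    ∃ U : Finset V, U.Nonempty ∧ U ≠ Finset.univ ∧
      (Γ = {s : Finset V | s.card = k ∧ s ⊆ U} ∨
       Γ = {s : Finset V | s.card = k ∧ U ⊆ s}) := by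
  classical
  obtain ⟨γ, hγ⟩ := hne
  have hγk := hΓcard γ hγ
  unfold TransOnPts at hintrans
  push Not at hintrans
  obtain ⟨x, y, hxy⟩ := hintrans
  obtain ⟨W, hW⟩ : ∃ W : Finset V, ∀ z, z ∈ W ↔ ∃ g ∈ G, g x = z :=
    ⟨Finset.univ.filter fun z => ∃ g ∈ G, g x = z, by simp⟩
  have hxW : x ∈ W := (hW x).2 ⟨1, G.one_mem, rfl⟩
  have hyW : y ∉ W := by
    rw [hW]
    rintro ⟨g, hg, h⟩
    exact hxy g hg h
  have hGW : ∀ g ∈ G, ∀ z, g z ∈ W ↔ z ∈ W := by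
    intro g hg z
    rw [hW, hW]
    constructor
    · rintro ⟨f, hf, h⟩
      exact ⟨g⁻¹ * f, G.mul_mem (G.inv_mem hg) hf, by simp [h]⟩
    · rintro ⟨f, hf, h⟩
      exact ⟨g * f, G.mul_mem hg hf, by simp [h]⟩
  have hΓc : ∀ s ∈ Γ, (s ∩ W).card = (γ ∩ W).card := by
    intro s hs
    obtain ⟨g, hg, h⟩ := hnt.1 γ hγ s hs
    rw [← h]
    exact aux_pact g γ W (hGW g hg)
  have hNc : ∀ s ∈ nbrSet k Γ, ∀ t ∈ nbrSet k Γ, (s ∩ W).card = (t ∩ W).card := by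
    intro s hs t ht
    obtain ⟨g, hg, h⟩ := hnt.2 s hs t ht
    rw [← h]
    exact (aux_pact g s W (hGW g hg)).symm
  -- swaps across the two sides give neighbours
  have hdown : ∀ u ∈ γ, u ∈ W → ∀ w, w ∉ γ → w ∉ W →
      ∃ β ∈ nbrSet k Γ, (β ∩ W).card + 1 = (γ ∩ W).card := by
    intro u hu huW w hw hwW
    have hi := aux_swap_inter γ W hu hw
    simp only [huW, hwW, if_true, if_false] at hi
    rcases aux_swap_mem k Γ hΓcard hγ hu hw with h | h
    · have := hΓc _ h; omega
    · exact ⟨_, h, by omega⟩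
  have hup : ∀ u ∈ γ, u ∉ W → ∀ w, w ∉ γ → w ∈ W →
      ∃ β ∈ nbrSet k Γ, (β ∩ W).card = (γ ∩ W).card + 1 := by
    intro u hu huW w hw hwW
    have hi := aux_swap_inter γ W hu hw
    simp only [huW, hwW, if_true, if_false] at hi
    rcases aux_swap_mem k Γ hΓcard hγ hu hw with h | h
    · have := hΓc _ h; omega
    · exact ⟨_, h, by omega⟩
  obtain ⟨p, hp⟩ : ∃ p, p ∈ γ := Finset.card_pos.1 (by omega)
  obtain ⟨q, hq⟩ : ∃ q, q ∉ γ := by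
    by_contra hcon
    push Not at hcon
    have : γ = Finset.univ := Finset.eq_univ_iff_forall.2 hcon
    rw [this, Finset.card_univ] at hγk
    omega
  have hex : ∃ β ∈ nbrSet k Γ, (β ∩ W).card ≠ (γ ∩ W).card := by
    by_contra hcon
    push Not at hcon
    have hd : ∀ u ∈ γ, u ∈ W → ∀ w, w ∉ γ → w ∈ W := by
      intro u hu huW w hw
      by_contra hwW
      obtain ⟨β, hβ, h⟩ := hdown u hu huW w hw hwW
      have := hcon β hβ; omega
    have hu' : ∀ u ∈ γ, u ∉ W → ∀ w, w ∉ γ → w ∉ W := by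
      intro u hu huW w hw hwW
      obtain ⟨β, hβ, h⟩ := hup u hu huW w hw hwW
      have := hcon β hβ; omega
    by_cases hpW : p ∈ W
    · have h1 := hd p hp hpW
      have hyγ : y ∈ γ := by
        by_contra h; exact hyW (h1 y h)
      exact hu' y hyγ hyW q hq (h1 q hq)
    · have h1 := hu' p hp hpW
      have hxγ : x ∈ γ := by
        by_contra h; exact h1 x h hxW
      exact h1 q hq (hd x hxγ hxW q hq)
  obtain ⟨β, hβ, hβc⟩ := hex
  have hmem : ∀ s, s ∈ Γ ↔ s.card = k ∧ (s ∩ W).card = (γ ∩ W).card := by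
    intro s
    constructor
    · intro hs
      exact ⟨hΓcard s hs, hΓc s hs⟩
    · rintro ⟨h1, h2⟩
      refine aux_conn k Γ hΓcard W _ ?_ s h1 h2 _ γ hγ rfl rfl
      intro β' hβ'
      rw [hNc β' hβ' β hβ]
      exact hβc
  have hsplit : ∀ s : Finset V, (s ∩ W).card + (s ∩ Wᶜ).card = s.card := by
    intro s
    rw [← Finset.sdiff_eq_inter_compl, Finset.card_inter_add_card_sdiff]
  -- membership in terms of the complement
  have hmem' : ∀ s, s ∈ Γ ↔ s.card = k ∧ (s ∩ Wᶜ).card = (γ ∩ Wᶜ).card := by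
    intro s
    rw [hmem]
    have := hsplit s
    have := hsplit γ
    constructor <;> rintro ⟨h1, h2⟩ <;> exact ⟨h1, by omega⟩
  have fin1 : ∀ T : Finset V, (∀ s, s ∈ Γ ↔ s.card = k ∧ (s ∩ T).card = (γ ∩ T).card) →
      (∀ z ∈ γ, z ∉ T) → Γ = {s : Finset V | s.card = k ∧ s ⊆ Tᶜ} := by
    intro T hT hz
    have h0 : γ ∩ T = ∅ := by
      ext z; simp only [Finset.mem_inter, Finset.notMem_empty, iff_false]
      exact fun h => hz z h.1 h.2
    ext s
    rw [hT, h0, Finset.card_empty, Finset.card_eq_zero, ← Finset.disjoint_iff_inter_eq_empty,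
      ← Finset.subset_compl_iff_disjoint_right]
    rfl
  have fin2 : ∀ T : Finset V, (∀ s, s ∈ Γ ↔ s.card = k ∧ (s ∩ T).card = (γ ∩ T).card) →
      (∀ z ∈ T, z ∈ γ) → Γ = {s : Finset V | s.card = k ∧ T ⊆ s} := by
    intro T hT hz
    have h0 : γ ∩ T = T := Finset.inter_eq_right.2 hz
    ext s
    rw [hT, h0]
    refine and_congr_right fun _ => ⟨fun h => ?_, fun h => by rw [Finset.inter_eq_right.2 h]⟩
    exact Finset.inter_eq_right.1
      (Finset.eq_of_subset_of_card_le Finset.inter_subset_right h.ge)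
  have hWne : W.Nonempty := ⟨x, hxW⟩
  have hWcne : Wᶜ.Nonempty := ⟨y, by simpa using hyW⟩
  have hWu : W ≠ Finset.univ := fun h => hyW (by rw [h]; simp)
  have hWcu : Wᶜ ≠ Finset.univ := fun h => by
    have : x ∈ Wᶜ := by rw [h]; simp
    simp [hxW] at this
  by_cases c1 : ∀ z ∈ γ, z ∉ W
  · exact ⟨Wᶜ, hWcne, hWcu, Or.inl (fin1 W hmem c1)⟩
  by_cases c2 : ∀ z ∈ W, z ∈ γ
  · exact ⟨W, hWne, hWu, Or.inr (fin2 W hmem c2)⟩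
  by_cases c3 : ∀ z ∈ γ, z ∉ Wᶜ
  · refine ⟨W, hWne, hWu, Or.inl ?_⟩
    have := fin1 Wᶜ hmem' c3
    rwa [compl_compl] at this
  by_cases c4 : ∀ z ∈ Wᶜ, z ∈ γ
  · exact ⟨Wᶜ, hWcne, hWcu, Or.inr (fin2 Wᶜ hmem' c4)⟩
  exfalso
  push Not at c1 c2 c3 c4
  obtain ⟨z1, h1, h1'⟩ := c1
  obtain ⟨z2, h2, h2'⟩ := c2
  obtain ⟨z3, h3, h3'⟩ := c3
  obtain ⟨z4, h4, h4'⟩ := c4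
  rw [Finset.mem_compl] at h3' h4
  obtain ⟨β1, hb1, e1⟩ := hdown z1 h1 h1' z4 h4' h4
  obtain ⟨β2, hb2, e2⟩ := hup z3 h3 h3' z2 h2' h2
  have := hNc β1 hb1 β2 hb2
  omega
end

section
/- Let 𝒰 be a partition of 𝒱 into b ≥ 4 parts each of size a ≥ 2, v = ab, and k = a·k₀ with 1 ≤ k₀ ≤ b−1. Let Γ₀ be a nonempty set of k₀-subsets of 𝒰 and Γ = Γ(a,Γ₀). If Γ₀ is A-strongly incidence-transitive (A is transitive on Γ₀ and, for γ₀ ∈ Γ₀, the stabiliser A_{γ₀} is transitive on γ₀ × (𝒰 ∖ γ₀)), then Γ is W-strongly incidence-transitive (W is transitive on Γ and, for γ ∈ Γ, the stabiliser W_γ is transitive on γ × (𝒱 ∖ γ)), and either Γ₀ is the set of all k₀-subsets of 𝒰 or δ(Γ₀) ≥ 2. -/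
variable {α : Type*} [DecidableEq α]

/-- `𝒰` is a partition of the point set into `b` parts each of size `a`. -/
def IsPartitionInto (𝒰 : Finset (Finset α)) (a b : ℕ) [Fintype α] : Prop :=
  𝒰.card = b ∧ (∀ U ∈ 𝒰, U.card = a) ∧
  (∀ U ∈ 𝒰, ∀ W ∈ 𝒰, U ≠ W → Disjoint U W) ∧ 𝒰.biUnion id = Finset.univ

/-- The `𝒰`-type of a subset `s`: the multiset of sizes of its intersections with the
parts of `𝒰`. -/
def utype (𝒰 : Finset (Finset α)) (s : Finset α) : Multiset ℕ :=
  𝒰.val.map fun U => (s ∩ U).card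

/-- The seven admissible `𝒰`-types (with their side conditions) for a `k`-subset,
for a partition into `b` parts of size `a` of a `v`-set. -/
def AdmissibleType (a b v k : ℕ) (t : Multiset ℕ) : Prop :=
  -- (1) {k, 0^{b-1}}, k ≤ a
  (t = k ::ₘ Multiset.replicate (b - 1) 0 ∧ k ≤ a) ∨
  -- (2) {k-v+a, a^{b-1}}, k ≥ v-a
  (t = (k - (v - a)) ::ₘ Multiset.replicate (b - 1) a ∧ v - a ≤ k) ∨
  -- (3) {1^k, 0^{b-k}}, k ≤ b
  (t = Multiset.replicate k 1 + Multiset.replicate (b - k) 0 ∧ k ≤ b) ∨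
  -- (4) {(a-1)^{v-k}, a^{b-v+k}}, k ≥ v-b
  (t = Multiset.replicate (v - k) (a - 1) + Multiset.replicate (b - (v - k)) a ∧
    v - b ≤ k) ∨
  -- (5) {c^b}, k = c·b, 1 < c ≤ a-1
  (∃ c, t = Multiset.replicate b c ∧ k = c * b ∧ 1 < c ∧ c ≤ a - 1) ∨
  -- (6) {(k-1)/2, (k+1)/2}, k odd, a ≥ 3, b = 2
  (t = (k - 1) / 2 ::ₘ (k + 1) / 2 ::ₘ (0 : Multiset ℕ) ∧ Odd k ∧ 3 ≤ a ∧ b = 2) ∨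
  -- (7) {1, 2^{(k-1)/2}, 0^{b-(k+1)/2}}, k odd, a = 2, b ≥ 3
  (t = 1 ::ₘ (Multiset.replicate ((k - 1) / 2) 2 +
        Multiset.replicate (b - (k + 1) / 2) 0) ∧ Odd k ∧ a = 2 ∧ 3 ≤ b)

/-- Membership in the wreath-product group `W ≅ S_a wr A`: permutations of the points
mapping parts of `𝒰` to parts of `𝒰` and inducing on `𝒰` a permutation preserving
`Γ₀` (i.e. lying in `A`). -/
def Wmem (𝒰 : Finset (Finset α)) (Γ₀ : Set (Finset (Finset α)))
    (g : Equiv.Perm α) : Prop :=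
  (∀ U ∈ 𝒰, pact g U ∈ 𝒰) ∧ (fun δ => δ.image (pact g)) '' Γ₀ = Γ₀

theorem exists_fiber_map {V : Type*} [DecidableEq V] (U T : Finset V) (h : U.card = T.card)
    (x y : V) (hx : x ∈ U) (hy : y ∈ T) :
    ∃ f : V → V, Set.InjOn f U ∧ (∀ z ∈ U, f z ∈ T) ∧ f x = y := by
  have e : U ≃ T := Finset.equivOfCardEq h
  let e' : U ≃ T := e.trans (Equiv.swap (e ⟨x, hx⟩) ⟨y, hy⟩)
  refine ⟨fun z => if hz : z ∈ U then (e' ⟨z, hz⟩ : V) else z, ?_, ?_, ?_⟩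
  · intro p hp q hq hpq
    have hp' : p ∈ U := hp
    have hq' : q ∈ U := hq
    simp only [hp', hq', dif_pos] at hpq
    have := e'.injective (Subtype.ext hpq)
    exact congrArg Subtype.val this
  · intro z hz
    simp only [hz, dif_pos]
    exact (e' ⟨z, hz⟩).2
  · simp [hx, e']

theorem exists_lift {V : Type*} [Fintype V] [DecidableEq V] (a b : ℕ)
    (𝒰 : Finset (Finset V)) (hpart : IsPartitionInto 𝒰 a b)
    (σ : Equiv.Perm (Finset V)) (hσ : ∀ U ∈ 𝒰, σ U ∈ 𝒰)
    (x y : Finset V → V) (hx : ∀ U ∈ 𝒰, x U ∈ U) (hy : ∀ U ∈ 𝒰, y U ∈ σ U) :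
    ∃ g : Equiv.Perm V, (∀ U ∈ 𝒰, pact g U = σ U) ∧ ∀ U ∈ 𝒰, g (x U) = y U := by
  obtain ⟨-, hcard, hdisj, hcov⟩ := hpart
  have huniq : ∀ U ∈ 𝒰, ∀ W ∈ 𝒰, ∀ z, z ∈ U → z ∈ W → U = W := by
    intro U hU W hW z h1 h2
    by_contra hne
    exact Finset.disjoint_left.mp (hdisj U hU W hW hne) h1 h2
  have hP : ∀ z : V, ∃ U ∈ 𝒰, z ∈ U := by
    intro z
    have : z ∈ 𝒰.biUnion id := by rw [hcov]; exact Finset.mem_univ z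
    simpa using this
  choose P hPm hPz using hP
  have hf : ∀ U : Finset V, ∃ f : V → V, U ∈ 𝒰 →
      Set.InjOn f U ∧ (∀ z ∈ U, f z ∈ σ U) ∧ f (x U) = y U := by
    intro U
    by_cases hU : U ∈ 𝒰
    · obtain ⟨f, h⟩ := exists_fiber_map U (σ U) (by rw [hcard U hU, hcard _ (hσ U hU)])
        (x U) (y U) (hx U hU) (hy U hU)
      exact ⟨f, fun _ => h⟩
    · exact ⟨id, fun h => absurd h hU⟩
  choose f hf using hf
  have hPU : ∀ U ∈ 𝒰, ∀ z ∈ U, P z = U := fun U hU z hz =>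
    huniq _ (hPm z) _ hU z (hPz z) hz
  have hinj : Function.Injective (fun z => f (P z) z) := by
    intro p q hpq
    simp only at hpq
    have h1 : f (P p) p ∈ σ (P p) := (hf _ (hPm p)).2.1 p (hPz p)
    have h2 : f (P q) q ∈ σ (P q) := (hf _ (hPm q)).2.1 q (hPz q)
    rw [← hpq] at h2
    have h3 : P p = P q :=
      σ.injective (huniq _ (hσ _ (hPm p)) _ (hσ _ (hPm q)) _ h1 h2)
    rw [← h3] at hpq
    exact (hf _ (hPm p)).1 (hPz p) (by rw [h3]; exact hPz q) hpq
  let g : Equiv.Perm V := Equiv.ofBijective _ (Finite.injective_iff_bijective.mp hinj)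
  have hg : ∀ z, g z = f (P z) z := fun z => rfl
  refine ⟨g, ?_, ?_⟩
  · intro U hU
    apply Finset.eq_of_subset_of_card_le
    · intro z hz
      obtain ⟨w, hw, rfl⟩ := Finset.mem_image.mp hz
      rw [hg, hPU U hU w hw]
      exact (hf U hU).2.1 w hw
    · rw [pact, Finset.card_image_of_injective _ g.injective, hcard U hU, hcard _ (hσ U hU)]
  · intro U hU
    rw [hg, hPU U hU _ (hx U hU)]
    exact (hf U hU).2.2

theorem lift_image {V : Type*} [DecidableEq V] (𝒰 : Finset (Finset V))
    (σ : Equiv.Perm (Finset V)) (g : Equiv.Perm V) (h : ∀ U ∈ 𝒰, pact g U = σ U)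
    (δ : Finset (Finset V)) (hδ : δ ⊆ 𝒰) : δ.image (pact g) = δ.image σ :=
  Finset.image_congr fun U hU => h U (hδ hU)

theorem lift_wmem {V : Type*} [DecidableEq V] (𝒰 : Finset (Finset V))
    (Γ₀ : Set (Finset (Finset V))) (hΓ₀ : ∀ γ₀ ∈ Γ₀, γ₀ ⊆ 𝒰)
    (σ : Equiv.Perm (Finset V)) (hσ : ∀ U ∈ 𝒰, σ U ∈ 𝒰)
    (hσΓ : (fun δ : Finset (Finset V) => δ.image σ) '' Γ₀ = Γ₀)
    (g : Equiv.Perm V) (h : ∀ U ∈ 𝒰, pact g U = σ U) : Wmem 𝒰 Γ₀ g := by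
  refine ⟨fun U hU => by rw [h U hU]; exact hσ U hU, ?_⟩
  conv_rhs => rw [← hσΓ]
  exact Set.image_congr fun δ hδ => lift_image 𝒰 σ g h δ (hΓ₀ δ hδ)

theorem lift_union {V : Type*} [DecidableEq V] (𝒰 : Finset (Finset V))
    (σ : Equiv.Perm (Finset V)) (g : Equiv.Perm V) (h : ∀ U ∈ 𝒰, pact g U = σ U)
    (δ : Finset (Finset V)) (hδ : δ ⊆ 𝒰) :
    pact g (δ.biUnion id) = (δ.image σ).biUnion id := by
  rw [← lift_image 𝒰 σ g h δ hδ]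
  ext z
  simp only [pact, Finset.mem_image, Finset.mem_biUnion, id]
  constructor
  · rintro ⟨w, ⟨U, hU, hw⟩, rfl⟩
    exact ⟨_, ⟨U, hU, rfl⟩, Finset.mem_image_of_mem _ hw⟩
  · rintro ⟨_, ⟨U, hU, rfl⟩, hz⟩
    obtain ⟨w, hw, rfl⟩ := Finset.mem_image.mp hz
    exact ⟨w, ⟨U, hU, hw⟩, rfl⟩

theorem all_of_exchange {β : Type*} [DecidableEq β] (𝒰 : Finset β) (k : ℕ)
    (Γ : Set (Finset β)) (hne : Γ.Nonempty) (hΓ : ∀ γ ∈ Γ, γ ⊆ 𝒰 ∧ γ.card = k)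
    (hex : ∀ γ ∈ Γ, ∀ u ∈ γ, ∀ w ∈ 𝒰, w ∉ γ → insert w (γ.erase u) ∈ Γ) :
    Γ = {δ | δ ⊆ 𝒰 ∧ δ.card = k} := by
  apply Set.Subset.antisymm hΓ
  rintro δ ⟨hδ, hδk⟩
  obtain ⟨γ₀, hγ₀⟩ := hne
  have key : ∀ n, ∀ γ ∈ Γ, (δ \ γ).card = n → δ ∈ Γ := by
    intro n
    induction n with
    | zero =>
      intro γ hγ h
      have h1 : δ ⊆ γ := Finset.sdiff_eq_empty_iff_subset.mp (Finset.card_eq_zero.mp h)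
      rw [Finset.eq_of_subset_of_card_le h1 (by rw [hδk, (hΓ γ hγ).2])]
      exact hγ
    | succ n ih =>
      intro γ hγ h
      obtain ⟨w, hw⟩ : (δ \ γ).Nonempty := Finset.card_pos.mp (by omega)
      have h2 : (γ \ δ).card = (δ \ γ).card :=
        Finset.card_sdiff_comm (by rw [hδk, (hΓ γ hγ).2])
      obtain ⟨u, hu⟩ : (γ \ δ).Nonempty := Finset.card_pos.mp (by omega)
      have hw' := Finset.mem_sdiff.mp hw
      have hu' := Finset.mem_sdiff.mp hu
      apply ih _ (hex γ hγ u hu'.1 w (hδ hw'.1) hw'.2)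
      have : δ \ insert w (γ.erase u) = (δ \ γ).erase w := by
        ext z
        simp only [Finset.mem_sdiff, Finset.mem_insert, Finset.mem_erase]
        constructor
        · rintro ⟨h1, h2⟩
          refine ⟨fun e => h2 (Or.inl e), h1, fun e => h2 (Or.inr ⟨?_, e⟩)⟩
          rintro rfl
          exact hu'.2 h1
        · rintro ⟨h1, h2, h3⟩
          exact ⟨h2, by rintro (e | e); exacts [h1 e, h3 e.2]⟩
      rw [this, Finset.card_erase_of_mem hw, h]
      rfl
  exact key _ γ₀ hγ₀ rfl

theorem image_exchange {β : Type*} [DecidableEq β] (σ : Equiv.Perm β) (s : Finset β) (u w : β) :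
    (insert w (s.erase u)).image σ = insert (σ w) ((s.image σ).erase (σ u)) := by
  rw [Finset.image_insert, Finset.image_erase σ.injective]

theorem exists_exchange {β : Type*} [DecidableEq β] (s t : Finset β) (hc : s.card = t.card)
    (hne : s ≠ t) (h : s.card - (s ∩ t).card < 2) :
    ∃ u ∈ s, ∃ w ∈ t, w ∉ s ∧ t = insert w (s.erase u) := by
  have h1 : (s \ t).card = s.card - (s ∩ t).card := by
    have := Finset.card_sdiff_add_card_inter s t
    omega
  have h2 : (s \ t).card = (t \ s).card := Finset.card_sdiff_comm hc
  have h3 : (s \ t).card ≠ 0 := by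
    intro h0
    have h4 : s ⊆ t := Finset.sdiff_eq_empty_iff_subset.mp (Finset.card_eq_zero.mp h0)
    exact hne (Finset.eq_of_subset_of_card_le h4 hc.ge)
  obtain ⟨u, hu⟩ := Finset.card_eq_one.mp (show (s \ t).card = 1 by omega)
  obtain ⟨w, hw⟩ := Finset.card_eq_one.mp (show (t \ s).card = 1 by omega)
  have hu' : ∀ z, (z ∈ s ∧ z ∉ t) ↔ z = u := fun z => by
    rw [← Finset.mem_sdiff, hu, Finset.mem_singleton]
  have hw' : ∀ z, (z ∈ t ∧ z ∉ s) ↔ z = w := fun z => by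
    rw [← Finset.mem_sdiff, hw, Finset.mem_singleton]
  refine ⟨u, ((hu' u).2 rfl).1, w, ((hw' w).2 rfl).1, ((hw' w).2 rfl).2, ?_⟩
  ext z
  simp only [Finset.mem_insert, Finset.mem_erase]
  have a1 := hu' z
  have a2 := hw' z
  tauto

/-- Lemma `lem:imprimex2`(a): if `Γ₀` is `A`-strongly
incidence-transitive then `Γ = Γ(a,Γ₀)` is `W`-strongly incidence-transitive, and either
`Γ₀` consists of all `k₀`-subsets of `𝒰` or `δ(Γ₀) ≥ 2`. -/
theorem stmt8 {V : Type*} [Fintype V] [DecidableEq V] (a b k₀ : ℕ)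
    (𝒰 : Finset (Finset V)) (hpart : IsPartitionInto 𝒰 a b)
    (ha : 2 ≤ a) (hb : 4 ≤ b) (hk₀ : 1 ≤ k₀) (hk₀' : k₀ ≤ b - 1)
    (Γ₀ : Set (Finset (Finset V))) (hΓ₀ne : Γ₀.Nonempty)
    (hΓ₀ : ∀ γ₀ ∈ Γ₀, γ₀ ⊆ 𝒰 ∧ γ₀.card = k₀)
    (Γ : Set (Finset V))
    (hΓ : Γ = {s : Finset V | ∃ γ₀ ∈ Γ₀, s = γ₀.biUnion id})
    -- Γ₀ is A-strongly incidence-transitive, where A is the group of permutations of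
    -- 𝒰 preserving Γ₀:
    (hA₁ : ∀ γ₀ ∈ Γ₀, ∀ γ₀' ∈ Γ₀, ∃ σ : Equiv.Perm (Finset V),
        (∀ U ∈ 𝒰, σ U ∈ 𝒰) ∧ ((fun δ => δ.image σ) '' Γ₀ = Γ₀) ∧ γ₀.image σ = γ₀')
    (hA₂ : ∀ γ₀ ∈ Γ₀, ∀ U₁ ∈ γ₀, ∀ W₁ ∈ 𝒰, W₁ ∉ γ₀ →
        ∀ U₂ ∈ γ₀, ∀ W₂ ∈ 𝒰, W₂ ∉ γ₀ →
        ∃ σ : Equiv.Perm (Finset V),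
          (∀ U ∈ 𝒰, σ U ∈ 𝒰) ∧ ((fun δ => δ.image σ) '' Γ₀ = Γ₀) ∧
          γ₀.image σ = γ₀ ∧ σ U₁ = U₂ ∧ σ W₁ = W₂) :
    -- Γ is W-strongly incidence-transitive
    ((∀ γ ∈ Γ, ∀ γ' ∈ Γ, ∃ g : Equiv.Perm V, Wmem 𝒰 Γ₀ g ∧ pact g γ = γ') ∧
     (∀ γ ∈ Γ, ∀ u ∈ γ, ∀ w ∉ γ, ∀ u' ∈ γ, ∀ w' ∉ γ,
        ∃ g : Equiv.Perm V, Wmem 𝒰 Γ₀ g ∧ pact g γ = γ ∧ g u = u' ∧ g w = w')) ∧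
    -- and either Γ₀ is all k₀-subsets of 𝒰, or δ(Γ₀) ≥ 2
    (Γ₀ = {δ : Finset (Finset V) | δ ⊆ 𝒰 ∧ δ.card = k₀} ∨ MinDistGE 2 Γ₀) := by
  have hsub : ∀ γ₀ ∈ Γ₀, γ₀ ⊆ 𝒰 := fun γ₀ h => (hΓ₀ γ₀ h).1
  have hpick : ∀ U : Finset V, ∃ z, U ∈ 𝒰 → z ∈ U := by
    intro U
    by_cases hU : U ∈ 𝒰
    · obtain ⟨z, hz⟩ : U.Nonempty := Finset.card_pos.mp (by rw [hpart.2.1 U hU]; omega)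
      exact ⟨z, fun _ => hz⟩
    · obtain ⟨W, hW⟩ : 𝒰.Nonempty := Finset.card_pos.mp (by rw [hpart.1]; omega)
      obtain ⟨z, hz⟩ : W.Nonempty := Finset.card_pos.mp (by rw [hpart.2.1 W hW]; omega)
      exact ⟨z, fun h => absurd h hU⟩
  choose pick hpick using hpick
  refine ⟨⟨?_, ?_⟩, ?_⟩
  · subst hΓ
    rintro _ ⟨γ, hγ, rfl⟩ _ ⟨γ', hγ', rfl⟩
    obtain ⟨σ, h1, h2, h3⟩ := hA₁ γ hγ γ' hγ'
    obtain ⟨g, hg, -⟩ := exists_lift a b 𝒰 hpart σ h1 pick (fun U => pick (σ U))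
      hpick (fun U hU => hpick _ (h1 U hU))
    refine ⟨g, lift_wmem 𝒰 Γ₀ hsub σ h1 h2 g hg, ?_⟩
    rw [lift_union 𝒰 σ g hg γ (hsub γ hγ), h3]
  · subst hΓ
    rintro _ ⟨γ, hγ, rfl⟩ u hu w hw u' hu' w' hw'
    have hout : ∀ w ∉ γ.biUnion id, ∃ W ∈ 𝒰, W ∉ γ ∧ w ∈ W := by
      intro w hw
      have : w ∈ 𝒰.biUnion id := by rw [hpart.2.2.2]; exact Finset.mem_univ w
      obtain ⟨W, hW, hwW⟩ := Finset.mem_biUnion.mp this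
      exact ⟨W, hW, fun h => hw (Finset.mem_biUnion.mpr ⟨W, h, hwW⟩), hwW⟩
    obtain ⟨U₁, hU₁, hu₁⟩ := Finset.mem_biUnion.mp hu
    obtain ⟨U₂, hU₂, hu₂⟩ := Finset.mem_biUnion.mp hu'
    obtain ⟨W₁, hW₁, hW₁n, hw₁⟩ := hout w hw
    obtain ⟨W₂, hW₂, hW₂n, hw₂⟩ := hout w' hw'
    obtain ⟨σ, h1, h2, h3, h4, h5⟩ := hA₂ γ hγ U₁ hU₁ W₁ hW₁ hW₁n U₂ hU₂ W₂ hW₂ hW₂n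
    have hne : W₁ ≠ U₁ := by
      rintro rfl
      exact hW₁n hU₁
    obtain ⟨g, hg, hgx⟩ := exists_lift a b 𝒰 hpart σ h1
      (fun Z => if Z = U₁ then u else if Z = W₁ then w else pick Z)
      (fun Z => if Z = U₁ then u' else if Z = W₁ then w' else pick (σ Z))
      (by
        intro Z hZ
        split_ifs with e1 e2
        · rw [e1]; exact hu₁
        · rw [e2]; exact hw₁
        · exact hpick Z hZ)
      (by
        intro Z hZ
        split_ifs with e1 e2
        · rw [e1, h4]; exact hu₂
        · rw [e2, h5]; exact hw₂
        · exact hpick _ (h1 Z hZ))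
    refine ⟨g, lift_wmem 𝒰 Γ₀ hsub σ h1 h2 g hg, ?_, ?_, ?_⟩
    · rw [lift_union 𝒰 σ g hg γ (hsub γ hγ), h3]
    · simpa using hgx U₁ (hsub γ hγ hU₁)
    · simpa [hne] using hgx W₁ hW₁
  · by_cases hmd : MinDistGE 2 Γ₀
    · exact Or.inr hmd
    left
    simp only [MinDistGE] at hmd
    push Not at hmd
    obtain ⟨s, hs, t, ht, hst, hlt⟩ := hmd
    obtain ⟨x, hx, y, hy, hys, hty⟩ :=
      exists_exchange s t (by rw [(hΓ₀ s hs).2, (hΓ₀ t ht).2]) hst hlt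
    apply all_of_exchange 𝒰 k₀ Γ₀ hΓ₀ne hΓ₀
    intro γ hγ u hu w hw hwγ
    obtain ⟨σ, h1, h2, h3⟩ := hA₁ s hs γ hγ
    have hσt : t.image σ ∈ Γ₀ := by
      rw [← h2]
      exact ⟨t, ht, rfl⟩
    rw [hty, image_exchange, h3] at hσt
    have hxγ : σ x ∈ γ := by rw [← h3]; exact Finset.mem_image_of_mem _ hx
    have hyγ : σ y ∉ γ := by
      rw [← h3]
      intro h
      obtain ⟨z, hz, he⟩ := Finset.mem_image.mp h
      rw [σ.injective he] at hz
      exact hys hz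
    obtain ⟨τ, k1, k2, k3, k4, k5⟩ :=
      hA₂ γ hγ (σ x) hxγ (σ y) (h1 y (hsub t ht hy)) hyγ u hu w hw hwγ
    have hfin : (insert (σ y) (γ.erase (σ x))).image τ ∈ Γ₀ := by
      rw [← k2]
      exact ⟨_, hσt, rfl⟩
    rwa [image_exchange, k3, k4, k5] at hfin
end

section
/- Let 𝒰 be a partition of 𝒱 into b ≥ 4 parts each of size a ≥ 2, v = ab, and k = a·k₀ with 1 ≤ k₀ ≤ b−1. Let Γ₀ be a nonempty set of k₀-subsets of 𝒰 and Γ = Γ(a,Γ₀). If W is transitive on Γ and on the neighbour set Γ₁ of Γ (i.e. Γ is W-neighbour-transitive), then either Γ₀ is A-strongly incidence-transitive (A is transitive on Γ₀ and, for γ₀ ∈ Γ₀, the stabiliser A_{γ₀} is transitive on γ₀ × (𝒰 ∖ γ₀)), or a = 2 and δ(Γ₀) = 1. -/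
variable {α : Type*} [DecidableEq α]

lemma inter_of_mem {V : Type*} [DecidableEq V] {𝒰 γ : Finset (Finset V)}
    (hd : ∀ U ∈ 𝒰, ∀ W ∈ 𝒰, U ≠ W → Disjoint U W) (hγ : γ ⊆ 𝒰)
    {X : Finset V} (hX : X ∈ 𝒰) {x : V} (hx : x ∈ X) :
    x ∈ γ.biUnion id ↔ X ∈ γ := by
  simp only [Finset.mem_biUnion, id]
  constructor
  · rintro ⟨Y, hY, hxY⟩
    by_cases h : X = Y
    · rwa [h]
    · exact absurd hxY (Finset.disjoint_left.mp (hd X hX Y (hγ hY) h) hx)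
  · exact fun h => ⟨X, h, hx⟩

lemma biUnion_inj_parts {V : Type*} [DecidableEq V] {𝒰 γ γ' : Finset (Finset V)}
    (hd : ∀ U ∈ 𝒰, ∀ W ∈ 𝒰, U ≠ W → Disjoint U W) (hne : ∀ U ∈ 𝒰, U.Nonempty)
    (hγ : γ ⊆ 𝒰) (hγ' : γ' ⊆ 𝒰) (h : γ.biUnion id = γ'.biUnion id) : γ = γ' := by
  ext X
  by_cases hX : X ∈ 𝒰
  · obtain ⟨x, hx⟩ := hne X hX
    rw [← inter_of_mem hd hγ hX hx, ← inter_of_mem hd hγ' hX hx, h]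
  · exact ⟨fun h => absurd (hγ h) hX, fun h => absurd (hγ' h) hX⟩

lemma beta_card {V : Type*} [DecidableEq V] {𝒰 γ : Finset (Finset V)} {a : ℕ}
    (hd : ∀ U ∈ 𝒰, ∀ W ∈ 𝒰, U ≠ W → Disjoint U W) (hc : ∀ U ∈ 𝒰, U.card = a)
    (hγ : γ ⊆ 𝒰) {U W X : Finset V} (hU : U ∈ γ) (hW : W ∈ 𝒰) (hWγ : W ∉ γ)
    {u w : V} (hu : u ∈ U) (hw : w ∈ W) (hX : X ∈ 𝒰) :
    (insert w ((γ.biUnion id).erase u) ∩ X).card =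
      if X = U then a - 1 else if X = W then 1 else if X ∈ γ then a else 0 := by
  have hmem : ∀ Y ∈ 𝒰, ∀ y ∈ Y, y ∈ X → X = Y := by
    intro Y hY y hy hyX
    by_contra h
    exact Finset.disjoint_left.mp (hd X hX Y hY h) hyX hy
  split_ifs with h1 h2 h3
  · subst h1
    rw [← hc X hX, ← Finset.card_erase_of_mem hu]
    congr 1
    ext x
    simp only [Finset.mem_inter, Finset.mem_insert, Finset.mem_erase]
    constructor
    · rintro ⟨rfl | h, hx⟩
      · exact absurd (hmem W hW _ hw hx ▸ hU) hWγ
      · exact ⟨h.1, hx⟩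
    · rintro ⟨h, hx⟩
      exact ⟨Or.inr ⟨h, (inter_of_mem hd hγ hX hx).2 hU⟩, hx⟩
  · subst h2
    rw [Finset.card_eq_one]
    refine ⟨w, ?_⟩
    ext x
    simp only [Finset.mem_inter, Finset.mem_insert, Finset.mem_erase, Finset.mem_singleton]
    constructor
    · rintro ⟨rfl | h, hx⟩
      · rfl
      · exact absurd ((inter_of_mem hd hγ hX hx).1 h.2) hWγ
    · rintro rfl
      exact ⟨Or.inl rfl, hw⟩
  · rw [← hc X hX]
    congr 1
    rw [Finset.inter_eq_right]
    intro x hx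
    simp only [Finset.mem_insert, Finset.mem_erase]
    refine Or.inr ⟨?_, (inter_of_mem hd hγ hX hx).2 h3⟩
    rintro rfl
    exact h1 (hmem U (hγ hU) _ hu hx)
  · rw [Finset.card_eq_zero, Finset.eq_empty_iff_forall_notMem]
    intro x
    simp only [Finset.mem_inter, Finset.mem_insert, Finset.mem_erase]
    rintro ⟨rfl | h, hx⟩
    · exact h2 (hmem W hW _ hw hx)
    · exact h3 ((inter_of_mem hd hγ hX hx).1 h.2)

lemma beta_nbr {V : Type*} [DecidableEq V] {𝒰 γ : Finset (Finset V)} {a k₀ : ℕ}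
    (ha : 2 ≤ a) (hd : ∀ U ∈ 𝒰, ∀ W ∈ 𝒰, U ≠ W → Disjoint U W)
    (hc : ∀ U ∈ 𝒰, U.card = a) {Γ₀ : Set (Finset (Finset V))}
    (hΓ₀ : ∀ γ₀ ∈ Γ₀, γ₀ ⊆ 𝒰 ∧ γ₀.card = k₀) (hγ : γ ∈ Γ₀)
    {U W : Finset V} (hU : U ∈ γ) (hW : W ∈ 𝒰) (hWγ : W ∉ γ)
    {u w : V} (hu : u ∈ U) (hw : w ∈ W) :
    insert w ((γ.biUnion id).erase u) ∈
      nbrSet (a * k₀) {s : Finset V | ∃ γ₀ ∈ Γ₀, s = γ₀.biUnion id} := by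
  obtain ⟨hs, hk⟩ := hΓ₀ γ hγ
  have hu' : u ∈ γ.biUnion id := (inter_of_mem hd hs (hs hU) hu).2 hU
  have hw' : w ∉ γ.biUnion id := fun h => hWγ ((inter_of_mem hd hs hW hw).1 h)
  have hcard : (γ.biUnion id).card = a * k₀ := by
    rw [Finset.card_biUnion, Finset.sum_congr rfl (f := fun u => (id u).card) (g := fun _ => a) (fun x hx => hc x (hs hx))]
    · rw [Finset.sum_const, hk, smul_eq_mul, mul_comm]
    · intro x hx y hy hxy
      exact hd x (hs hx) y (hs hy) hxy
  have hpos : 0 < (γ.biUnion id).card := Finset.card_pos.mpr ⟨u, hu'⟩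
  refine ⟨?_, ?_, γ.biUnion id, ⟨γ, hγ, rfl⟩, ?_, ?_⟩
  · rw [Finset.card_insert_of_notMem (fun h => hw' (Finset.mem_of_mem_erase h)),
      Finset.card_erase_of_mem hu', ← hcard]
    omega
  · rintro ⟨γ', hγ', he⟩
    have h1 := beta_card hd hc hs hU hW hWγ hu hw (hs hU)
    rw [if_pos rfl, he] at h1
    by_cases h : U ∈ γ'
    · rw [Finset.inter_eq_right.mpr, hc U (hs hU)] at h1
      · omega
      · exact fun x hx => (inter_of_mem hd (hΓ₀ γ' hγ').1 (hs hU) hx).2 h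
    · rw [Finset.card_eq_zero.mpr] at h1
      · omega
      · rw [Finset.eq_empty_iff_forall_notMem]
        intro x hx
        rw [Finset.mem_inter] at hx
        exact h ((inter_of_mem hd (hΓ₀ γ' hγ').1 (hs hU) hx.2).1 hx.1)
  · intro h
    exact hw' (h ▸ Finset.mem_insert_self _ _)
  · rw [← hcard, ← Finset.card_erase_of_mem hu']
    congr 1
    ext x
    simp only [Finset.mem_inter, Finset.mem_insert, Finset.mem_erase]
    constructor
    · rintro ⟨h, rfl | h'⟩
      · exact absurd h hw'
      · exact h'
    · exact fun h => ⟨h.2, Or.inr h⟩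

lemma pact_inj {V : Type*} [DecidableEq V] (g : Equiv.Perm V) :
    Function.Injective (pact g) := Finset.image_injective g.injective

/-- The permutation of finsets induced by a permutation of points. -/
noncomputable def pactEquiv {V : Type*} [Fintype V] [DecidableEq V] (g : Equiv.Perm V) :
    Equiv.Perm (Finset V) :=
  Equiv.ofBijective (pact g) (Finite.injective_iff_bijective.mp (pact_inj g))

lemma pactEquiv_coe {V : Type*} [Fintype V] [DecidableEq V] (g : Equiv.Perm V) :
    (pactEquiv g : Finset V → Finset V) = pact g := rfl

lemma pact_biUnion {V : Type*} [DecidableEq V] (g : Equiv.Perm V)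
    (γ : Finset (Finset V)) :
    (γ.image (pact g)).biUnion id = pact g (γ.biUnion id) := by
  ext x
  simp only [pact, Finset.mem_biUnion, Finset.mem_image, id]
  constructor
  · rintro ⟨_, ⟨Y, hY, rfl⟩, hx⟩
    obtain ⟨y, hy, rfl⟩ := Finset.mem_image.mp hx
    exact ⟨y, ⟨Y, hY, hy⟩, rfl⟩
  · rintro ⟨y, ⟨Y, hY, hy⟩, rfl⟩
    exact ⟨_, ⟨Y, hY, rfl⟩, Finset.mem_image_of_mem _ hy⟩

/-- Lemma `lem:imprimex2`(b): if `W` is neighbour-transitive on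
`Γ = Γ(a,Γ₀)`, then either `Γ₀` is `A`-strongly incidence-transitive, or `a = 2` and
`δ(Γ₀) = 1`. -/
theorem stmt9 {V : Type*} [Fintype V] [DecidableEq V] (a b k₀ : ℕ)
    (𝒰 : Finset (Finset V)) (hpart : IsPartitionInto 𝒰 a b)
    (ha : 2 ≤ a) (hb : 4 ≤ b) (hk₀ : 1 ≤ k₀) (hk₀' : k₀ ≤ b - 1)
    (Γ₀ : Set (Finset (Finset V))) (hΓ₀ne : Γ₀.Nonempty)
    (hΓ₀ : ∀ γ₀ ∈ Γ₀, γ₀ ⊆ 𝒰 ∧ γ₀.card = k₀)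
    (Γ : Set (Finset V))
    (hΓ : Γ = {s : Finset V | ∃ γ₀ ∈ Γ₀, s = γ₀.biUnion id})
    -- W is transitive on Γ and on the neighbour set of Γ (as a code of (a·k₀)-subsets)
    (hW₁ : ∀ γ ∈ Γ, ∀ γ' ∈ Γ, ∃ g : Equiv.Perm V, Wmem 𝒰 Γ₀ g ∧ pact g γ = γ')
    (hW₂ : ∀ β ∈ nbrSet (a * k₀) Γ, ∀ β' ∈ nbrSet (a * k₀) Γ,
        ∃ g : Equiv.Perm V, Wmem 𝒰 Γ₀ g ∧ pact g β = β') :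
    -- either Γ₀ is A-strongly incidence-transitive ...
    ((∀ γ₀ ∈ Γ₀, ∀ γ₀' ∈ Γ₀, ∃ σ : Equiv.Perm (Finset V),
        (∀ U ∈ 𝒰, σ U ∈ 𝒰) ∧ ((fun δ => δ.image σ) '' Γ₀ = Γ₀) ∧ γ₀.image σ = γ₀') ∧
     (∀ γ₀ ∈ Γ₀, ∀ U₁ ∈ γ₀, ∀ W₁ ∈ 𝒰, W₁ ∉ γ₀ →
        ∀ U₂ ∈ γ₀, ∀ W₂ ∈ 𝒰, W₂ ∉ γ₀ →
        ∃ σ : Equiv.Perm (Finset V),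
          (∀ U ∈ 𝒰, σ U ∈ 𝒰) ∧ ((fun δ => δ.image σ) '' Γ₀ = Γ₀) ∧
          γ₀.image σ = γ₀ ∧ σ U₁ = U₂ ∧ σ W₁ = W₂)) ∨
    -- ... or a = 2 and δ(Γ₀) = 1
    (a = 2 ∧ minDist Γ₀ = 1) := by
  obtain ⟨hcb, hc, hd, hcov⟩ := hpart
  have hne : ∀ U ∈ 𝒰, U.Nonempty := fun U hU => by
    rw [← Finset.card_pos, hc U hU]; omega
  subst hΓ
  by_cases hmin : a = 2 ∧ minDist Γ₀ = 1
  · exact Or.inr hmin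
  refine Or.inl ⟨?_, ?_⟩
  · intro γ hγ γ' hγ'
    obtain ⟨g, ⟨hg, hgΓ⟩, h⟩ := hW₁ _ ⟨γ, hγ, rfl⟩ _ ⟨γ', hγ', rfl⟩
    refine ⟨pactEquiv g, hg, hgΓ, ?_⟩
    rw [pactEquiv_coe]
    refine biUnion_inj_parts hd hne ?_ (hΓ₀ γ' hγ').1 ?_
    · intro X hX
      obtain ⟨Y, hY, rfl⟩ := Finset.mem_image.mp hX
      exact hg Y ((hΓ₀ γ hγ).1 hY)
    · rw [pact_biUnion, h]
  · intro γ hγ U₁ hU₁ W₁ hW₁ hWγ₁ U₂ hU₂ W₂ hW₂' hWγ₂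
    obtain ⟨hs, hk⟩ := hΓ₀ γ hγ
    obtain ⟨u₁, hu₁⟩ := hne U₁ (hs hU₁)
    obtain ⟨u₂, hu₂⟩ := hne U₂ (hs hU₂)
    obtain ⟨w₁, hw₁⟩ := hne W₁ hW₁
    obtain ⟨w₂, hw₂⟩ := hne W₂ hW₂'
    obtain ⟨g, ⟨hg, hgΓ⟩, h⟩ := hW₂ _ (beta_nbr ha hd hc hΓ₀ hγ hU₁ hW₁ hWγ₁ hu₁ hw₁)
      _ (beta_nbr ha hd hc hΓ₀ hγ hU₂ hW₂' hWγ₂ hu₂ hw₂)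
    have key : ∀ X ∈ 𝒰,
        (if pact g X = U₂ then a - 1 else if pact g X = W₂ then 1
          else if pact g X ∈ γ then a else 0) =
        (if X = U₁ then a - 1 else if X = W₁ then 1 else if X ∈ γ then a else 0) := by
      intro X hX
      rw [← beta_card hd hc hs hU₁ hW₁ hWγ₁ hu₁ hw₁ hX,
        ← beta_card hd hc hs hU₂ hW₂' hWγ₂ hu₂ hw₂ (hg X hX), ← h]
      simp only [pact]
      rw [← Finset.image_inter _ _ g.injective, Finset.card_image_of_injective _ g.injective]
    have hUW₁ : W₁ ≠ U₁ := fun e => hWγ₁ (e ▸ hU₁)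
    have hUW₂ : W₂ ≠ U₂ := fun e => hWγ₂ (e ▸ hU₂)
    have kU := key U₁ (hs hU₁)
    have kW := key W₁ hW₁
    have kO : ∀ X ∈ γ, X ≠ U₁ → pact g X ∈ γ := by
      intro X hX hXU
      have hXW : X ≠ W₁ := fun e => hWγ₁ (e ▸ hX)
      have := key X (hs hX)
      rw [if_neg hXU, if_neg hXW, if_pos hX] at this
      split_ifs at this <;> first | assumption | omega
    rw [if_pos rfl] at kU
    rw [if_neg hUW₁, if_pos rfl] at kW
    have hinj : pact g W₁ ≠ pact g U₁ := fun e => hUW₁ (pact_inj g e)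
    have hU : pact g U₁ = U₂ ∨ pact g U₁ = W₂ := by
      split_ifs at kU <;> first | (left; assumption) | (right; assumption) | omega
    have hW : pact g W₁ = U₂ ∨ pact g W₁ = W₂ := by
      split_ifs at kW <;> first | (left; assumption) | (right; assumption) | omega
    rcases hU with hU | hU
    · have hW' : pact g W₁ = W₂ := hW.resolve_left (fun e => hinj (e.trans hU.symm))
      refine ⟨pactEquiv g, hg, hgΓ, ?_, hU, hW'⟩
      rw [pactEquiv_coe]
      apply Finset.eq_of_subset_of_card_le
      · intro X hX
        obtain ⟨Y, hY, rfl⟩ := Finset.mem_image.mp hX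
        by_cases e : Y = U₁
        · rw [e, hU]; exact hU₂
        · exact kO Y hY e
      · rw [Finset.card_image_of_injective _ (pact_inj g)]
    · exfalso
      apply hmin
      have ha2 : a = 2 := by
        rw [hU, if_neg hUW₂, if_pos rfl] at kU
        omega
      refine ⟨ha2, ?_⟩
      have hγ' : γ.image (pact g) ∈ Γ₀ := hgΓ ▸ ⟨γ, hγ, rfl⟩
      have hWm : W₂ ∈ γ.image (pact g) := hU ▸ Finset.mem_image_of_mem _ hU₁
      have hneq : γ ≠ γ.image (pact g) := fun e => hWγ₂ (e ▸ hWm)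
      have hlt : ∀ s ∈ Γ₀, ∀ t ∈ Γ₀, s ≠ t → (s ∩ t).card < s.card := by
        intro s hs' t ht hst
        refine lt_of_le_of_ne (Finset.card_le_card Finset.inter_subset_left) fun e => hst ?_
        have := Finset.eq_of_subset_of_card_le (Finset.inter_subset_left (s₁ := s) (s₂ := t)) e.ge
        exact Finset.eq_of_subset_of_card_le (Finset.inter_eq_left.mp this)
          (by rw [(hΓ₀ s hs').2, (hΓ₀ t ht).2])
      have hge : γ.card - 1 ≤ (γ ∩ γ.image (pact g)).card := by
        rw [← Finset.card_erase_of_mem hU₁,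
          ← Finset.card_image_of_injective (γ.erase U₁) (pact_inj g)]
        apply Finset.card_le_card
        intro X hX
        obtain ⟨Y, hY, rfl⟩ := Finset.mem_image.mp hX
        rw [Finset.mem_erase] at hY
        exact Finset.mem_inter.mpr ⟨kO Y hY.2 hY.1, Finset.mem_image_of_mem _ hY.2⟩
      have h1 := hlt _ hγ _ hγ' hneq
      have hmem : 1 ∈ {d | ∃ s ∈ Γ₀, ∃ t ∈ Γ₀, s ≠ t ∧ d = s.card - (s ∩ t).card} :=
        ⟨γ, hγ, _, hγ', hneq, by omega⟩
      apply le_antisymm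
      · exact Nat.sInf_le hmem
      · obtain ⟨s, hs', t, ht, hst, e⟩ := Nat.sInf_mem ⟨1, hmem⟩
        have := hlt s hs' t ht hst
        unfold minDist
        omega
end

section
/- Suppose 2 ≤ k ≤ v−2, Γ is a nonempty proper subset of the set of k-element subsets of 𝒱, G ≤ Sym(𝒱) leaves Γ invariant, Γ is G-neighbour-transitive, and G is transitive and imprimitive on 𝒱 (G preserves some partition of 𝒱 into b parts of size a with a > 1 and b > 1). Then there is a G-invariant partition 𝒰 of 𝒱 into b parts each of size a (a > 1, b > 1) such that either (i) Γ is the set of all k-subsets of 𝒱 whose 𝒰-type equals t, for one of the seven admissible types t, or (ii) a divides k and every codeword of Γ is a union of parts of 𝒰, i.e. Γ = Γ(a,Γ₀) := { ⋃_{U ∈ γ₀} U : γ₀ ∈ Γ₀ } for some set Γ₀ of (k/a)-subsets of 𝒰. -/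
variable {α : Type*} [DecidableEq α]

/-- Exchange the point `u` of `γ` for the point `w`. -/
def sw {V : Type*} [DecidableEq V] (γ : Finset V) (u w : V) : Finset V := insert w (γ.erase u)

section helpers
variable {V : Type*} [DecidableEq V]

lemma sw_card {γ : Finset V} {u w : V} (hu : u ∈ γ) (hw : w ∉ γ) : (sw γ u w).card = γ.card := by
  unfold sw
  rw [Finset.card_insert_of_notMem (by simp [hw]), Finset.card_erase_of_mem hu]
  have := Finset.card_pos.mpr ⟨u, hu⟩
  omega

lemma sw_adj {γ : Finset V} {u w : V} (hu : u ∈ γ) (hw : w ∉ γ) : JAdj γ.card γ (sw γ u w) := by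
  refine ⟨?_, ?_⟩
  · intro h
    apply hw
    rw [h]
    simp [sw]
  · have : γ ∩ sw γ u w = γ.erase u := by
      ext z
      simp only [sw, Finset.mem_inter, Finset.mem_insert, Finset.mem_erase]
      constructor
      · rintro ⟨h1, rfl | h2⟩
        · exact absurd h1 hw
        · exact h2
      · rintro h
        exact ⟨h.2, Or.inr h⟩
    rw [this, Finset.card_erase_of_mem hu]

lemma sw_inter {γ U : Finset V} {u w : V} :
    sw γ u w ∩ U = if w ∈ U then insert w ((γ ∩ U).erase u) else (γ ∩ U).erase u := by
  ext z
  split_ifs with h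
  · simp only [sw, Finset.mem_inter, Finset.mem_insert, Finset.mem_erase]
    constructor
    · tauto
    · rintro (rfl | h') <;> tauto
  · simp only [sw, Finset.mem_inter, Finset.mem_insert, Finset.mem_erase]
    constructor
    · rintro ⟨rfl | h1, h2⟩ <;> tauto
    · tauto

lemma sw_inter_none {γ U : Finset V} {u w : V} (hu : u ∉ U) (hw : w ∉ U) :
    (sw γ u w ∩ U).card = (γ ∩ U).card := by
  rw [sw_inter, if_neg hw, Finset.erase_eq_of_notMem (by simp [hu])]

lemma sw_inter_left {γ U : Finset V} {u w : V} (hu : u ∈ U) (huγ : u ∈ γ) (hw : w ∉ U) :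
    (sw γ u w ∩ U).card = (γ ∩ U).card - 1 := by
  rw [sw_inter, if_neg hw, Finset.card_erase_of_mem (by simp [hu, huγ])]

lemma sw_inter_right {γ U : Finset V} {u w : V} (hu : u ∉ U) (hwγ : w ∉ γ) (hw : w ∈ U) :
    (sw γ u w ∩ U).card = (γ ∩ U).card + 1 := by
  rw [sw_inter, if_pos hw, Finset.erase_eq_of_notMem (by simp [hu]),
    Finset.card_insert_of_notMem (by simp [hwγ])]

lemma sw_inter_both {γ U : Finset V} {u w : V} (hu : u ∈ U) (huγ : u ∈ γ) (hwγ : w ∉ γ)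
    (hw : w ∈ U) : (sw γ u w ∩ U).card = (γ ∩ U).card := by
  rw [sw_inter, if_pos hw, Finset.card_insert_of_notMem (by simp [hwγ]),
    Finset.card_erase_of_mem (by simp [hu, huγ])]
  have := Finset.card_pos.mpr ⟨u, Finset.mem_inter.mpr ⟨huγ, hu⟩⟩
  omega

lemma sw_sdiff_lt {γ s : Finset V} {u w : V} (hu : u ∈ γ) (hus : u ∉ s) (hws : w ∈ s) :
    (sw γ u w \ s).card < (γ \ s).card := by
  apply Finset.card_lt_card
  rw [Finset.ssubset_iff_of_subset]
  · refine ⟨u, by simp [hu, hus], ?_⟩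
    simp only [sw, Finset.mem_sdiff, Finset.mem_insert, Finset.mem_erase]
    rintro ⟨rfl | h, _⟩ <;> tauto
  · intro z
    simp only [sw, Finset.mem_sdiff, Finset.mem_insert, Finset.mem_erase]
    rintro ⟨rfl | h, _⟩ <;> tauto

/-- the two values at distinct parts split off the type. -/
lemma utype_split {P : Finset (Finset V)} {U W : Finset V} (hU : U ∈ P) (hW : W ∈ P) (h : U ≠ W)
    (γ : Finset V) :
    utype P γ = (γ ∩ U).card ::ₘ (γ ∩ W).card ::ₘ
      ((P.erase U).erase W).val.map (fun Z => (γ ∩ Z).card) := by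
  have h1 : P.val = U ::ₘ W ::ₘ ((P.erase U).erase W).val := by
    rw [Finset.erase_val, Multiset.cons_erase, Finset.erase_val, Multiset.cons_erase]
    · exact hU
    · have : W ∈ P.erase U := by simp [hW, h.symm]
      exact this
  unfold utype
  conv_lhs => rw [h1]
  simp

lemma mem_utype {P : Finset (Finset V)} {U : Finset V} (hU : U ∈ P) (γ : Finset V) :
    (γ ∩ U).card ∈ utype P γ := Multiset.mem_map_of_mem _ hU

lemma utype_count {P : Finset (Finset V)} {U W : Finset V} (hU : U ∈ P) (hW : W ∈ P) (h : U ≠ W)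
    (γ : Finset V) (p : ℕ → Prop) [DecidablePred p] (hc : (utype P γ).countP p ≤ 1)
    (h1 : p (γ ∩ U).card) (h2 : p (γ ∩ W).card) : False := by
  rw [utype_split hU hW h, Multiset.countP_cons_of_pos _ h1, Multiset.countP_cons_of_pos _ h2] at hc
  omega

variable [Fintype V] {P : Finset (Finset V)} {a b : ℕ}

lemma part_ex (hP : IsPartitionInto P a b) (z : V) : ∃ U ∈ P, z ∈ U := by
  have : z ∈ P.biUnion id := by rw [hP.2.2.2]; simp
  simpa using this

lemma part_uniq (hP : IsPartitionInto P a b) {U W : Finset V} (hU : U ∈ P) (hW : W ∈ P) {z : V} (h1 : z ∈ U) (h2 : z ∈ W) :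
    U = W := by
  by_contra h
  exact Finset.disjoint_left.mp (hP.2.2.1 U hU W hW h) h1 h2

lemma utype_same (hP : IsPartitionInto P a b) {γ U : Finset V} {u w : V} (hU : U ∈ P) (hu : u ∈ U) (hw : w ∈ U)
    (huγ : u ∈ γ) (hwγ : w ∉ γ) : utype P (sw γ u w) = utype P γ := by
  unfold utype
  apply Multiset.map_congr rfl
  intro Z hZ
  by_cases h : Z = U
  · subst h
    exact sw_inter_both hu huγ hwγ hw
  · exact sw_inter_none (fun h' => h (part_uniq hP hZ hU h' hu))
      (fun h' => h (part_uniq hP hZ hU h' hw))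

lemma utype_diff (hP : IsPartitionInto P a b) {γ U W : Finset V} {u w : V} (hU : U ∈ P) (hW : W ∈ P) (hne : U ≠ W)
    (hu : u ∈ U) (hw : w ∈ W) (huγ : u ∈ γ) (hwγ : w ∉ γ) :
    ∃ R : Multiset ℕ, utype P γ = (γ ∩ U).card ::ₘ (γ ∩ W).card ::ₘ R ∧
      utype P (sw γ u w) = ((γ ∩ U).card - 1) ::ₘ ((γ ∩ W).card + 1) ::ₘ R := by
  refine ⟨_, utype_split hU hW hne γ, ?_⟩
  have huW : u ∉ W := fun h => hne (part_uniq hP hU hW hu h)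
  have hwU : w ∉ U := fun h => hne (part_uniq hP hU hW h hw)
  rw [utype_split hU hW hne, sw_inter_left hu huγ hwU, sw_inter_right huW hwγ hw]
  congr 2
  apply Multiset.map_congr rfl
  intro Z hZ
  have hZ' : Z ∈ (P.erase U).erase W := hZ
  simp only [Finset.mem_erase] at hZ'
  exact sw_inter_none (fun h => hZ'.2.1 (part_uniq hP hZ'.2.2 hU h hu))
    (fun h => hZ'.1 (part_uniq hP hZ'.2.2 hW h hw))

lemma utype_triv (hP : IsPartitionInto P a b) {γ U W : Finset V} {u w : V} (hU : U ∈ P) (hW : W ∈ P) (hne : U ≠ W)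
    (hu : u ∈ U) (hw : w ∈ W) (huγ : u ∈ γ) (hwγ : w ∉ γ)
    (h : (γ ∩ U).card = (γ ∩ W).card + 1) : utype P (sw γ u w) = utype P γ := by
  obtain ⟨R, h1, h2⟩ := utype_diff hP hU hW hne hu hw huγ hwγ
  rw [h1, h2, h, Multiset.cons_swap]
  simp

lemma utype_sum (hP : IsPartitionInto P a b) (γ : Finset V) : (utype P γ).sum = γ.card := by
  have h : γ = P.biUnion (fun U => γ ∩ U) := by
    ext z
    simp only [Finset.mem_biUnion, Finset.mem_inter]
    constructor
    · intro hz
      obtain ⟨U, hU, hz'⟩ := part_ex hP z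
      exact ⟨U, hU, hz, hz'⟩
    · rintro ⟨U, -, h, -⟩
      exact h
  conv_rhs => rw [h]
  rw [Finset.card_biUnion]
  · rfl
  · intro U hU W hW hne
    exact (hP.2.2.1 U hU W hW hne).mono Finset.inter_subset_right Finset.inter_subset_right

lemma utype_card (hP : IsPartitionInto P a b) (γ : Finset V) : (utype P γ).card = b := by
  simp [utype, hP.1]

lemma card_V (hP : IsPartitionInto P a b) : Fintype.card V = a * b := by
  have h := utype_sum hP (Finset.univ : Finset V)
  rw [Finset.card_univ] at h
  rw [← h]
  have : utype P Finset.univ = Multiset.replicate b a := by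
    rw [Multiset.eq_replicate]
    refine ⟨utype_card hP _, ?_⟩
    intro n hn
    unfold utype at hn
    rw [Multiset.mem_map] at hn
    obtain ⟨U, hU, rfl⟩ := hn
    rw [Finset.univ_inter]
    exact hP.2.1 U hU
  rw [this]
  simp [mul_comm]

lemma utype_pact {g : Equiv.Perm V} (hg : ∀ U ∈ P, pact g U ∈ P) (γ : Finset V) :
    utype P (pact g γ) = utype P γ := by
  have hinj : Function.Injective (pact g : Finset V → Finset V) :=
    Finset.image_injective g.injective
  have himg : P.image (pact g) = P := by
    apply Finset.eq_of_subset_of_card_le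
    · intro U hU
      obtain ⟨W, hW, rfl⟩ := Finset.mem_image.mp hU
      exact hg W hW
    · rw [Finset.card_image_of_injective _ hinj]
  have hval : P.val = P.val.map (pact g) := by
    conv_lhs => rw [← himg]
    rw [Finset.image_val_of_injOn hinj.injOn]
  unfold utype
  conv_lhs => rw [hval]
  rw [Multiset.map_map]
  apply Multiset.map_congr rfl
  intro U _
  simp only [Function.comp, pact]
  rw [← Finset.image_inter _ _ g.injective, Finset.card_image_of_injective _ g.injective]

/-- Two nontrivial moves leading to the same type come from the same pair of values. -/
lemma nontriv_unique {t t1 R R' : Multiset ℕ} {p q p' q' : ℕ} (hp : 0 < p) (hp' : 0 < p')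
    (h : p ≠ q + 1) (ht : t = p ::ₘ q ::ₘ R) (ht' : t = p' ::ₘ q' ::ₘ R')
    (h1 : t1 = (p - 1) ::ₘ (q + 1) ::ₘ R) (h1' : t1 = (p' - 1) ::ₘ (q' + 1) ::ₘ R') :
    p = p' ∧ q = q' := by
  obtain ⟨p, rfl⟩ := Nat.exists_eq_succ_of_ne_zero hp.ne'
  obtain ⟨p', rfl⟩ := Nat.exists_eq_succ_of_ne_zero hp'.ne'
  have s2 := fun (f : ℕ → ℤ) => congrArg (fun m => (Multiset.map f m).sum) (ht.symm.trans ht')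
  have s2' := fun (f : ℕ → ℤ) => congrArg (fun m => (Multiset.map f m).sum) (h1.symm.trans h1')
  have e1 := s2 (fun n => (n : ℤ) ^ 2)
  have e2 := s2' (fun n => (n : ℤ) ^ 2)
  have e3 := s2 (fun n => (n : ℤ) ^ 3)
  have e4 := s2' (fun n => (n : ℤ) ^ 3)
  simp only [Multiset.map_cons, Multiset.sum_cons, Nat.succ_sub_one, Nat.succ_eq_add_one] at e1 e2 e3 e4
  push_cast at e1 e2 e3 e4
  have d : (p : ℤ) - q = p' - q' := by linarith
  have d' : ((p : ℤ) - q) * (p + q) = (p' - q') * (p' + q') := by linarith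
  rw [← d] at d'
  have hn : (p : ℤ) - q ≠ 0 := by omega
  have := mul_left_cancel₀ hn d'
  constructor <;> omega

end helpers

section conn
variable {V : Type*} [DecidableEq V] [Fintype V] {P : Finset (Finset V)} {a b : ℕ}

lemma inter_sub_of_no_sdiff {γ s U : Finset V} (h : ∀ z ∈ U, z ∈ γ → z ∈ s) :
    γ ∩ U ⊆ s ∩ U := by
  intro z hz
  rw [Finset.mem_inter] at hz ⊢
  exact ⟨h z hz.2 hz.1, hz.2⟩

lemma inter_lt {γ s U : Finset V} {u : V} (h : ∀ z ∈ U, z ∈ s → z ∈ γ) (hu : u ∈ U)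
    (huγ : u ∈ γ) (hus : u ∉ s) : (s ∩ U).card < (γ ∩ U).card := by
  apply Finset.card_lt_card
  rw [Finset.ssubset_iff_of_subset (inter_sub_of_no_sdiff h)]
  exact ⟨u, by simp [hu, huγ], by simp [hus]⟩

lemma ex_sdiff {γ s U : Finset V} (h : (s ∩ U).card < (γ ∩ U).card) :
    ∃ u ∈ U, u ∈ γ ∧ u ∉ s := by
  by_contra! h'
  have := Finset.card_le_card (inter_sub_of_no_sdiff h')
  omega

lemma improve (hP : IsPartitionInto P a b) {Γ : Set (Finset V)} {t : Multiset ℕ}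
    (ht : ∀ γ ∈ Γ, utype P γ = t)
    (Hcl : ∀ γ ∈ Γ, ∀ u ∈ γ, ∀ w ∉ γ, utype P (sw γ u w) = t → sw γ u w ∈ Γ)
    {s γ : Finset V} (hγ : γ ∈ Γ) (hcard : γ.card = s.card) (hne : γ ≠ s) :
    (∃ γ' ∈ Γ, (γ' \ s).card < (γ \ s).card) ∨
    (∃ U ∈ P, ∃ W ∈ P, U ≠ W ∧ (s ∩ U).card < (γ ∩ U).card ∧ (γ ∩ W).card < (s ∩ W).card ∧
      ∀ U' ∈ P, ∀ W' ∈ P, (s ∩ U').card < (γ ∩ U').card → (γ ∩ W').card < (s ∩ W').card →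
        (γ ∩ U').card ≠ (γ ∩ W').card + 1) := by
  by_cases hI : ∃ γ' ∈ Γ, (γ' \ s).card < (γ \ s).card
  · exact Or.inl hI
  right
  obtain ⟨u, huγ, hus⟩ : ∃ u ∈ γ, u ∉ s := by
    by_contra! h
    exact hne (Finset.eq_of_subset_of_card_le h hcard.ge)
  obtain ⟨w, hws, hwγ⟩ : ∃ w ∈ s, w ∉ γ := by
    by_contra! h
    exact hne (Finset.eq_of_subset_of_card_le h hcard.le).symm
  have nest : ∀ U ∈ P, ∀ u' ∈ U, ∀ w' ∈ U, u' ∈ γ → u' ∉ s → w' ∈ s → w' ∈ γ := by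
    intro U hU u' hu' w' hw' h1 h2 h3
    by_contra h4
    exact hI ⟨_, Hcl γ hγ u' h1 w' h4 ((utype_same hP hU hu' hw' h1 h4).trans (ht γ hγ)),
      sw_sdiff_lt h1 h2 h3⟩
  obtain ⟨U, hU, huU⟩ := part_ex hP u
  obtain ⟨W, hW, hwW⟩ := part_ex hP w
  have hUW : U ≠ W := by
    rintro rfl
    exact hwγ (nest U hU u huU w hwW huγ hus hws)
  refine ⟨U, hU, W, hW, hUW, ?_, ?_, ?_⟩
  · exact inter_lt (fun z hz hzs => nest U hU u huU z hz huγ hus hzs) huU huγ hus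
  · refine inter_lt (fun z hz hzγ => ?_) hwW hws hwγ
    by_contra hzs
    exact hwγ (nest W hW z hz w hwW hzγ hzs hws)
  · intro U' hU' W' hW' h1 h2 h3
    obtain ⟨u', hu'U, hu'γ, hu's⟩ := ex_sdiff h1
    obtain ⟨w', hw'W, hw's, hw'γ⟩ := ex_sdiff h2
    have hne' : U' ≠ W' := by
      rintro rfl
      omega
    exact hI ⟨_, Hcl γ hγ u' hu'γ w' hw'γ
      ((utype_triv hP hU' hW' hne' hu'U hw'W hu'γ hw'γ h3).trans (ht γ hγ)),
      sw_sdiff_lt hu'γ hu's hw's⟩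

lemma descend {Γ : Set (Finset V)} {s : Finset V} (n : ℕ)
    (H : ∀ γ ∈ Γ, γ ≠ s → (γ \ s).card ≤ n → ∃ γ' ∈ Γ, (γ' \ s).card < (γ \ s).card) :
    ∀ m ≤ n, ∀ γ ∈ Γ, (γ \ s).card = m → s ∈ Γ := by
  intro m
  induction m using Nat.strong_induction_on with
  | _ m ih =>
    intro hm γ hγ hc
    by_cases h : γ = s
    · exact h ▸ hγ
    · obtain ⟨γ', hγ', hlt⟩ := H γ hγ h (hc ▸ hm)
      exact ih _ (hc ▸ hlt) (by omega) γ' hγ' rfl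

variable {k : ℕ} {Γ : Set (Finset V)} {t : Multiset ℕ}

lemma conn_two
    (hP : IsPartitionInto P a b) (hk : ∀ γ ∈ Γ, γ.card = k)
    (hne : Γ.Nonempty)
    (ht : ∀ γ ∈ Γ, utype P γ = t)
    (Hcl : ∀ γ ∈ Γ, ∀ u ∈ γ, ∀ w ∉ γ, utype P (sw γ u w) = t → sw γ u w ∈ Γ)
    (c : ℕ) (hc : ∀ n ∈ t, n = c ∨ n = c + 1) :
    Γ = {s | s.card = k ∧ utype P s = t} := by
  apply Set.Subset.antisymm
  · exact fun γ hγ => ⟨hk γ hγ, ht γ hγ⟩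
  rintro s ⟨hs, hst⟩
  obtain ⟨γ, hγ⟩ := hne
  refine descend (γ \ s).card ?_ _ le_rfl γ hγ rfl
  intro δ hδ hδs _
  rcases improve hP ht Hcl hδ ((hk δ hδ).trans hs.symm) hδs with h | ⟨U, hU, W, hW, h, h1, h2, h3⟩
  · exact h
  · exfalso
    have := h3 U hU W hW h1 h2
    have a1 := hc _ (ht δ hδ ▸ mem_utype hU δ)
    have a2 := hc _ (ht δ hδ ▸ mem_utype hW δ)
    have a3 := hc _ (hst ▸ mem_utype hU s)
    have a4 := hc _ (hst ▸ mem_utype hW s)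
    omega

lemma conn_one
    (hP : IsPartitionInto P a b) (hk : ∀ γ ∈ Γ, γ.card = k)
    (ht : ∀ γ ∈ Γ, utype P γ = t)
    (Hcl : ∀ γ ∈ Γ, ∀ u ∈ γ, ∀ w ∉ γ, utype P (sw γ u w) = t → sw γ u w ∈ Γ)
    (hov : ∀ s : Finset V, s.card = k → ∃ γ ∈ Γ, (γ \ s).card < k)
    (hc : t.countP (fun n => n ≠ 0) ≤ 1) :
    Γ = {s | s.card = k ∧ utype P s = t} := by
  apply Set.Subset.antisymm
  · exact fun γ hγ => ⟨hk γ hγ, ht γ hγ⟩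
  rintro s ⟨hs, hst⟩
  obtain ⟨γ, hγ, hlt⟩ := hov s hs
  refine descend (k - 1) ?_ _ (by omega) γ hγ rfl
  intro δ hδ hδs hle
  rcases improve hP ht Hcl hδ ((hk δ hδ).trans hs.symm) hδs with h | ⟨U, hU, W, hW, h, h1, h2, h3⟩
  · exact h
  · exfalso
    have key : δ \ s = δ := by
      rw [Finset.sdiff_eq_self_iff_disjoint, Finset.disjoint_left]
      intro z hz hzs
      obtain ⟨Z, hZ, hzZ⟩ := part_ex hP z
      have p1 : (δ ∩ Z).card ≠ 0 := (Finset.card_pos.mpr ⟨z, by simp [hz, hzZ]⟩).ne'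
      have p2 : (s ∩ Z).card ≠ 0 := (Finset.card_pos.mpr ⟨z, by simp [hzs, hzZ]⟩).ne'
      have e1 : Z = U := by
        by_contra e
        exact utype_count hZ hU e δ _ (by rw [ht δ hδ]; exact hc) p1 (by omega)
      have e2 : Z = W := by
        by_contra e
        exact utype_count hZ hW e s _ (by rw [hst]; exact hc) p2 (by omega)
      exact h (e1.symm.trans e2)
    rw [key, hk δ hδ] at hle
    have := hk γ hγ
    omega

lemma conn_co
    (hP : IsPartitionInto P a b) (hk : ∀ γ ∈ Γ, γ.card = k)
    (ht : ∀ γ ∈ Γ, utype P γ = t)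
    (Hcl : ∀ γ ∈ Γ, ∀ u ∈ γ, ∀ w ∉ γ, utype P (sw γ u w) = t → sw γ u w ∈ Γ)
    (hov : ∀ s : Finset V, s.card = k → ∃ γ ∈ Γ, (γ \ s).card < sᶜ.card)
    (hc : t.countP (fun n => n ≠ a) ≤ 1) :
    Γ = {s | s.card = k ∧ utype P s = t} := by
  apply Set.Subset.antisymm
  · exact fun γ hγ => ⟨hk γ hγ, ht γ hγ⟩
  rintro s ⟨hs, hst⟩
  obtain ⟨γ, hγ, hlt⟩ := hov s hs
  refine descend (sᶜ.card - 1) ?_ _ (by omega) γ hγ rfl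
  intro δ hδ hδs hle
  rcases improve hP ht Hcl hδ ((hk δ hδ).trans hs.symm) hδs with h | ⟨U, hU, W, hW, h, h1, h2, h3⟩
  · exact h
  · exfalso
    have lea : ∀ Z ∈ P, ∀ r : Finset V, (r ∩ Z).card ≤ a := fun Z hZ r =>
      (hP.2.1 Z hZ) ▸ Finset.card_le_card Finset.inter_subset_right
    have lta : ∀ Z ∈ P, ∀ r : Finset V, ∀ z ∈ Z, z ∉ r → (r ∩ Z).card ≠ a := by
      intro Z hZ r z hz hzr he
      have : r ∩ Z = Z := Finset.eq_of_subset_of_card_le Finset.inter_subset_right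
        (by rw [hP.2.1 Z hZ, he])
      rw [← this] at hz
      exact hzr (Finset.mem_inter.mp hz).1
    have key : sᶜ ⊆ δ \ s := by
      intro z hz
      rw [Finset.mem_compl] at hz
      rw [Finset.mem_sdiff]
      refine ⟨?_, hz⟩
      by_contra hzs
      obtain ⟨Z, hZ, hzZ⟩ := part_ex hP z
      have p1 := lta Z hZ s z hzZ hz
      have p2 := lta Z hZ δ z hzZ hzs
      have q1 := lea U hU δ
      have q2 := lea W hW s
      have e1 : Z = U := by
        by_contra e
        exact utype_count hZ hU e s _ (by rw [hst]; exact hc) p1 (by omega)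
      have e2 : Z = W := by
        by_contra e
        exact utype_count hZ hW e δ _ (by rw [ht δ hδ]; exact hc) p2 (by omega)
      exact h (e1.symm.trans e2)
    have := Finset.card_le_card key
    omega

lemma conn_seven
    (hP : IsPartitionInto P a b) (hk : ∀ γ ∈ Γ, γ.card = k)
    (hne : Γ.Nonempty)
    (ht : ∀ γ ∈ Γ, utype P γ = t)
    (Hcl : ∀ γ ∈ Γ, ∀ u ∈ γ, ∀ w ∉ γ, utype P (sw γ u w) = t → sw γ u w ∈ Γ)
    (hv : ∀ n ∈ t, n = 0 ∨ n = 1 ∨ n = 2) (h1t : 1 ∈ t)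
    (hc : t.countP (fun n => n = 1) ≤ 1) :
    Γ = {s | s.card = k ∧ utype P s = t} := by
  apply Set.Subset.antisymm
  · exact fun γ hγ => ⟨hk γ hγ, ht γ hγ⟩
  rintro s ⟨hs, hst⟩
  obtain ⟨γ, hγ⟩ := hne
  refine descend (γ \ s).card ?_ _ le_rfl γ hγ rfl
  intro δ hδ hδs _
  rcases improve hP ht Hcl hδ ((hk δ hδ).trans hs.symm) hδs with h | ⟨U, hU, W, hW, h, h1, h2, h3⟩
  · exact h
  · have vδ : ∀ Z ∈ P, _ := fun Z hZ => hv _ (ht δ hδ ▸ mem_utype hZ δ)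
    have vs : ∀ Z ∈ P, _ := fun Z hZ => hv _ (hst ▸ mem_utype hZ s)
    have uδ : ∀ Z ∈ P, ∀ Y ∈ P, (δ ∩ Z).card = 1 → (δ ∩ Y).card = 1 → Z = Y := by
      intro Z hZ Y hY z1 y1
      by_contra e
      exact utype_count hZ hY e δ (fun n => n = 1) (by rw [ht δ hδ]; exact hc) z1 y1
    have us : ∀ Z ∈ P, ∀ Y ∈ P, (s ∩ Z).card = 1 → (s ∩ Y).card = 1 → Z = Y := by
      intro Z hZ Y hY z1 y1
      by_contra e
      exact utype_count hZ hY e s (fun n => n = 1) (by rw [hst]; exact hc) z1 y1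
    have gen : ∀ U ∈ P, ∀ W ∈ P, (s ∩ U).card < (δ ∩ U).card → (δ ∩ W).card < (s ∩ W).card →
        (δ ∩ U).card = 2 ∧ (δ ∩ W).card = 0 := by
      intro U hU W hW h1 h2
      have := h3 U hU W hW h1 h2
      have c1 := vδ U hU
      have c2 := vδ W hW
      have c3 := vs U hU
      have c4 := vs W hW
      by_cases hb : (δ ∩ U).card = 1 ∧ (δ ∩ W).card = 1
      · have := uδ U hU W hW hb.1 hb.2
        subst this
        omega
      · omega
    obtain ⟨g1, g2⟩ := gen U hU W hW h1 h2
    obtain ⟨I, hI, hI1⟩ : ∃ I ∈ P, (δ ∩ I).card = 1 := by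
      have := (ht δ hδ) ▸ h1t
      unfold utype at this
      rw [Multiset.mem_map] at this
      exact this
    have hIs : (s ∩ I).card = 1 := by
      rcases lt_trichotomy (s ∩ I).card (δ ∩ I).card with hl | hl | hl
      · have := gen I hI W hW hl h2
        omega
      · omega
      · have := gen U hU I hI h1 hl
        omega
    have hIU : I ≠ U := by rintro rfl; omega
    have hIW : I ≠ W := by rintro rfl; omega
    have hW2 : (s ∩ W).card = 2 := by
      have c4 := vs W hW
      have : (s ∩ W).card ≠ 1 := fun e => hIW (us I hI W hW hIs e)
      omega
    obtain ⟨w1, w2, hww, hsW⟩ := Finset.card_eq_two.mp hW2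
    have hw1 : w1 ∈ s ∩ W := by simp [hsW]
    have hw2 : w2 ∈ s ∩ W := by simp [hsW]
    rw [Finset.mem_inter] at hw1 hw2
    have hδW : ∀ z ∈ W, z ∉ δ := by
      intro z hz hzδ
      have : z ∈ δ ∩ W := by simp [hz, hzδ]
      rw [Finset.card_eq_zero.mp g2] at this
      simp at this
    obtain ⟨i, hi⟩ := Finset.card_pos.mp (by omega : 0 < (δ ∩ I).card)
    rw [Finset.mem_inter] at hi
    obtain ⟨u, huU, huδ, hus⟩ := ex_sdiff h1
    have w1δ := hδW w1 hw1.2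
    have w2δ := hδW w2 hw2.2
    have m1 : sw δ i w1 ∈ Γ := Hcl δ hδ i hi.1 w1 w1δ
      ((utype_triv hP hI hW hIW hi.2 hw1.2 hi.1 w1δ (by omega)).trans (ht δ hδ))
    have hui : u ≠ i := by
      rintro rfl
      exact hIU (part_uniq hP hI hU hi.2 huU)
    have u1 : u ∈ sw δ i w1 := by simp [sw, hui, huδ]
    have w2n : w2 ∉ sw δ i w1 := by simp [sw, hww.symm, w2δ]
    have iW : i ∉ W := fun h' => hIW (part_uniq hP hI hW hi.2 h')
    have iU : i ∉ U := fun h' => hIU (part_uniq hP hI hU hi.2 h')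
    have w1U : w1 ∉ U := fun h' => h (part_uniq hP hU hW h' hw1.2)
    have c1 : (sw δ i w1 ∩ U).card = 2 := by rw [sw_inter_none iU w1U, g1]
    have c2 : (sw δ i w1 ∩ W).card = 1 := by rw [sw_inter_right iW w1δ hw1.2, g2]
    have m2 : sw (sw δ i w1) u w2 ∈ Γ := Hcl _ m1 u u1 w2 w2n
      ((utype_triv hP hU hW h huU hw2.2 u1 w2n (by omega)).trans (ht _ m1))
    refine ⟨_, m2, (sw_sdiff_lt u1 hus hw2.1).trans_le ?_⟩
    apply Finset.card_le_card
    intro z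
    simp only [sw, Finset.mem_sdiff, Finset.mem_insert, Finset.mem_erase]
    rintro ⟨rfl | h', h''⟩
    · exact absurd hw1.1 h''
    · exact ⟨h'.2, h''⟩

end conn

lemma two_vals (t : Multiset ℕ) (c d : ℕ) (h : ∀ n ∈ t, n = c ∨ n = d) :
    ∃ m m', t = Multiset.replicate m c + Multiset.replicate m' d := by
  induction t using Multiset.induction_on with
  | empty => exact ⟨0, 0, by simp⟩
  | cons x s ih =>
    obtain ⟨m, m', e⟩ := ih (fun n hn => h n (Multiset.mem_cons_of_mem hn))
    rcases h x (Multiset.mem_cons_self x s) with rfl | rfl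
    · exact ⟨m + 1, m', by rw [e, Multiset.replicate_succ, Multiset.cons_add]⟩
    · exact ⟨m, m' + 1, by rw [e, Multiset.replicate_succ, Multiset.add_cons]⟩

/-- Proposition `imprim`: classification of the neighbour-transitive
codes whose group is transitive and imprimitive on the points. -/
theorem stmt10 {V : Type*} [Fintype V] [DecidableEq V] (k : ℕ)
    (hk : 2 ≤ k) (hk' : k ≤ Fintype.card V - 2)
    (Γ : Set (Finset V)) (hΓcard : ∀ γ ∈ Γ, γ.card = k)
    (hne : Γ.Nonempty) (hproper : Γ ≠ {s : Finset V | s.card = k})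
    (G : Subgroup (Equiv.Perm V)) (hinv : Invariant (G : Set (Equiv.Perm V)) Γ)
    (hnt : NbrTrans (G : Set (Equiv.Perm V)) k Γ)
    (htrans : TransOnPts (G : Set (Equiv.Perm V)))
    (himprim : ∃ (a b : ℕ) (Part : Finset (Finset V)), 1 < a ∧ 1 < b ∧
        IsPartitionInto Part a b ∧ ∀ g ∈ G, ∀ U ∈ Part, pact g U ∈ Part) :
    ∃ (a b : ℕ) (𝒰 : Finset (Finset V)), 1 < a ∧ 1 < b ∧
      IsPartitionInto 𝒰 a b ∧ (∀ g ∈ G, ∀ U ∈ 𝒰, pact g U ∈ 𝒰) ∧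
      ((∃ t : Multiset ℕ, AdmissibleType a b (a * b) k t ∧
          Γ = {s : Finset V | s.card = k ∧ utype 𝒰 s = t}) ∨
       (∃ k₀ : ℕ, k = a * k₀ ∧
          ∃ Γ₀ : Set (Finset (Finset V)),
            (∀ γ₀ ∈ Γ₀, γ₀ ⊆ 𝒰 ∧ γ₀.card = k₀) ∧
            Γ = {s : Finset V | ∃ γ₀ ∈ Γ₀, s = γ₀.biUnion id})) := by
  obtain ⟨a, b, P, ha, hb, hP, hGP⟩ := himprim
  refine ⟨a, b, P, ha, hb, hP, hGP, ?_⟩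
  obtain ⟨γ0, hγ0⟩ := hne
  have hne : Γ.Nonempty := ⟨γ0, hγ0⟩
  have hv : Fintype.card V = a * b := card_V hP
  have hab : 4 ≤ a * b := Nat.mul_le_mul ha hb
  have hk2 : k + 2 ≤ a * b := by omega
  obtain ⟨t, ht0⟩ : ∃ t, t = utype P γ0 := ⟨_, rfl⟩
  have ht : ∀ γ ∈ Γ, utype P γ = t := by
    intro γ hγ
    obtain ⟨g, hg, rfl⟩ := hnt.1 γ0 hγ0 γ hγ
    rw [ht0]
    exact utype_pact (hGP g hg) γ0
  have ht1 : ∀ β ∈ nbrSet k Γ, ∀ β' ∈ nbrSet k Γ, utype P β' = utype P β := by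
    intro β hβ β' hβ'
    obtain ⟨g, hg, rfl⟩ := hnt.2 β hβ β' hβ'
    exact utype_pact (hGP g hg) β
  have hnbr : ∀ γ ∈ Γ, ∀ u ∈ γ, ∀ w ∉ γ, sw γ u w ∉ Γ → sw γ u w ∈ nbrSet k Γ := by
    intro γ hγ u hu w hw h
    refine ⟨(sw_card hu hw).trans (hΓcard γ hγ), h, γ, hγ, ?_⟩
    have := sw_adj hu hw
    rwa [hΓcard γ hγ] at this
  obtain ⟨x, hx⟩ : ∃ x : Finset V → ℕ, x = fun U => (γ0 ∩ U).card := ⟨_, rfl⟩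
  have hxt : t = P.val.map x := by rw [ht0, hx]; rfl
  have hxa : ∀ U ∈ P, x U ≤ a := fun U hU => by
    rw [hx, ← hP.2.1 U hU]
    exact Finset.card_le_card Finset.inter_subset_right
  have htsum : t.sum = k := by rw [ht0, utype_sum hP, hΓcard γ0 hγ0]
  have htcard : t.card = b := by rw [ht0, utype_card hP]
  have hmem : ∀ n ∈ t, ∃ U ∈ P, x U = n := by
    intro n hn
    rw [hxt, Multiset.mem_map] at hn
    exact hn
  -- a move between two given parts
  have hmove : ∀ U ∈ P, ∀ W ∈ P, U ≠ W → 0 < x U → x W < a → ∃ u ∈ γ0, ∃ w ∉ γ0, ∃ R : Multiset ℕ,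
      t = x U ::ₘ x W ::ₘ R ∧ utype P (sw γ0 u w) = (x U - 1) ::ₘ (x W + 1) ::ₘ R := by
    intro U hU W hW hne h1 h2
    rw [hx] at h1 h2
    obtain ⟨u, hu⟩ := Finset.card_pos.mp h1
    rw [Finset.mem_inter] at hu
    obtain ⟨w, hwW, hw⟩ : ∃ w ∈ W, w ∉ γ0 := by
      by_contra! h
      have : γ0 ∩ W = W := Finset.inter_eq_right.mpr h
      have e := hP.2.1 W hW
      simp only [this] at h2
      omega
    refine ⟨u, hu.1, w, hw, ?_⟩
    rw [ht0, hx]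
    exact utype_diff hP hU hW hne hu.2 hwW hu.1 hw
  have hnotin : ∀ U ∈ P, ∀ W ∈ P, U ≠ W → 0 < x U → x W < a → x U ≠ x W + 1 →
      ∃ β ∈ nbrSet k Γ, ∃ R : Multiset ℕ, utype P β ≠ t ∧
      t = x U ::ₘ x W ::ₘ R ∧ utype P β = (x U - 1) ::ₘ (x W + 1) ::ₘ R := by
    intro U hU W hW hne h1 h2 h3
    obtain ⟨u, hu, w, hw, R, e1, e2⟩ := hmove U hU W hW hne h1 h2
    have hdiff : utype P (sw γ0 u w) ≠ t := by
      intro h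
      rw [e2, e1] at h
      have c := congrArg (fun m => (Multiset.map (fun n : ℕ => (n : ℤ) ^ 2) m).sum) h
      obtain ⟨p, hp⟩ := Nat.exists_eq_succ_of_ne_zero h1.ne'
      simp only [hp, Multiset.map_cons, Multiset.sum_cons, Nat.succ_sub_one,
        Nat.succ_eq_add_one] at c
      push_cast at c
      have : (p : ℤ) = x W := by linarith
      omega
    exact ⟨_, hnbr γ0 hγ0 u hu w hw (fun h => hdiff (ht _ h)), R, hdiff, e1, e2⟩
  have huniq : ∀ U ∈ P, ∀ W ∈ P, U ≠ W → 0 < x U → x W < a → x U ≠ x W + 1 →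
      ∀ U' ∈ P, ∀ W' ∈ P, U' ≠ W' → 0 < x U' → x W' < a → x U' = x W' + 1 ∨
        (x U = x U' ∧ x W = x W') := by
    intro U hU W hW hne h1 h2 h3 U' hU' W' hW' hne' h1' h2'
    by_cases h3' : x U' = x W' + 1
    · exact Or.inl h3'
    right
    obtain ⟨β, hβ, R, -, e1, e2⟩ := hnotin U hU W hW hne h1 h2 h3
    obtain ⟨β', hβ', R', -, e1', e2'⟩ := hnotin U' hU' W' hW' hne' h1' h2' h3'
    rw [ht1 β hβ β' hβ'] at e2'
    exact nontriv_unique h1 h1' h3 e1 e1' e2 e2'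
  have hclose : ∀ U ∈ P, ∀ W ∈ P, U ≠ W → 0 < x U → x W < a → x U ≠ x W + 1 →
      ∀ γ ∈ Γ, ∀ u ∈ γ, ∀ w ∉ γ, utype P (sw γ u w) = t → sw γ u w ∈ Γ := by
    intro U hU W hW hne h1 h2 h3 γ hγ u hu w hw h
    by_contra hn
    obtain ⟨β, hβ, R, hd, -⟩ := hnotin U hU W hW hne h1 h2 h3
    exact hd ((ht1 _ (hnbr γ hγ u hu w hw hn) β hβ).trans h)
  have htwo : ∀ c d, (∀ U ∈ P, x U = c ∨ x U = d) → ∃ m m', m + m' = b ∧ m * c + m' * d = k ∧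
      t = Multiset.replicate m c + Multiset.replicate m' d := by
    intro c d h
    obtain ⟨m, m', e⟩ := two_vals t c d (fun n hn => by
      obtain ⟨U, hU, rfl⟩ := hmem n hn
      exact h U hU)
    refine ⟨m, m', ?_, ?_, e⟩
    · rw [e] at htcard
      simpa using htcard
    · rw [e] at htsum
      simpa using htsum
  -- two-valued conclusion
  have hfin2 : ∀ c, (∀ U ∈ P, x U = c ∨ x U = c + 1) →
      (∀ γ ∈ Γ, ∀ u ∈ γ, ∀ w ∉ γ, utype P (sw γ u w) = t → sw γ u w ∈ Γ) →
      Γ = {s : Finset V | s.card = k ∧ utype P s = t} := by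
    intro c h hcl
    refine conn_two hP hΓcard hne ht hcl c (fun n hn => ?_)
    obtain ⟨U, hU, rfl⟩ := hmem n hn
    exact h U hU
  by_cases hA : ∀ U ∈ P, x U = 0 ∨ x U = a
  · right
    obtain ⟨m, m', hm, hmk, -⟩ := htwo 0 a hA
    refine ⟨m', by rw [← hmk]; ring, {γ₀ | γ₀ ⊆ P ∧ γ₀.biUnion id ∈ Γ}, ?_, ?_⟩
    · rintro γ₀ ⟨h1, h2⟩
      refine ⟨h1, ?_⟩
      have h3 := hΓcard _ h2
      rw [Finset.card_biUnion] at h3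
      · rw [Finset.sum_congr rfl (g := fun _ => a)] at h3
        · rw [Finset.sum_const, smul_eq_mul] at h3
          have : γ₀.card * a = m' * a := by rw [h3, ← hmk]; ring
          exact Nat.eq_of_mul_eq_mul_right (by omega) this
        · exact fun U hU => hP.2.1 U (h1 hU)
      · exact fun U hU W hW hne => hP.2.2.1 U (h1 hU) W (h1 hW) hne
    · ext s
      constructor
      · intro hs
        have hsU : ∀ U ∈ P, (s ∩ U).card = 0 ∨ (s ∩ U).card = a := by
          intro U hU
          obtain ⟨W, hW, h⟩ := hmem _ (ht s hs ▸ mem_utype hU s)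
          rw [← h]
          exact hA W hW
        have key : s = (P.filter (fun U => U ⊆ s)).biUnion id := by
          ext z
          simp only [Finset.mem_biUnion, Finset.mem_filter, id]
          constructor
          · intro hz
            obtain ⟨U, hU, hzU⟩ := part_ex hP z
            refine ⟨U, ⟨hU, ?_⟩, hzU⟩
            rcases hsU U hU with h | h
            · have : z ∈ s ∩ U := by simp [hz, hzU]
              rw [Finset.card_eq_zero.mp h] at this
              simp at this
            · have : s ∩ U = U := Finset.eq_of_subset_of_card_le Finset.inter_subset_right
                (by rw [hP.2.1 U hU, h])
              exact Finset.inter_eq_right.mp this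
          · rintro ⟨U, ⟨_, h⟩, hz⟩
            exact h hz
        refine ⟨_, ⟨Finset.filter_subset _ _, ?_⟩, key⟩
        rw [← key]
        exact hs
      · rintro ⟨γ₀, ⟨_, h⟩, rfl⟩
        exact h
  left
  refine ⟨t, ?_⟩
  push Not at hA
  obtain ⟨U0, hU0, hp0, hpa⟩ := hA
  have hpa' : x U0 < a := lt_of_le_of_ne (hxa U0 hU0) hpa
  have hp0' : 0 < x U0 := Nat.pos_of_ne_zero hp0
  have hsplit0 : t = x U0 ::ₘ (P.erase U0).val.map x := by
    rw [hxt, Finset.erase_val, ← Multiset.map_cons, Multiset.cons_erase]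
    exact hU0
  have hcard0 : (P.erase U0).card = b - 1 := by
    rw [Finset.card_erase_of_mem hU0, hP.1]
  obtain ⟨Uo, hUo, hUo0⟩ : ∃ U ∈ P, U ≠ U0 := by
    apply Finset.exists_mem_ne
    rw [hP.1]
    exact hb
  by_cases hB : ∀ U ∈ P, U ≠ U0 → x U = 0 ∨ x U = a
  · by_cases hB1 : ∀ U ∈ P, U ≠ U0 → x U = 0
    · -- type (1)
      have hrep : (P.erase U0).val.map x = Multiset.replicate (b - 1) 0 := by
        rw [Multiset.eq_replicate]
        refine ⟨by rw [Multiset.card_map, Finset.card_val, hcard0], ?_⟩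
        intro n hn
        rw [Multiset.mem_map] at hn
        obtain ⟨U, hU, rfl⟩ := hn
        have hU' : U ∈ P.erase U0 := hU
        rw [Finset.mem_erase] at hU'
        exact hB1 U hU'.2 hU'.1
      rw [hrep] at hsplit0
      have hpk : x U0 = k := by
        rw [hsplit0] at htsum
        simpa using htsum
      have hz := hB1 Uo hUo hUo0
      rw [hpk] at hsplit0
      refine ⟨Or.inl ⟨hsplit0, by omega⟩, ?_⟩
      refine conn_one hP hΓcard ht
        (hclose U0 hU0 Uo hUo hUo0.symm hp0' (by omega) (by omega)) ?_ ?_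
      · intro s hs
        obtain ⟨z, hz⟩ := Finset.card_pos.mp (by omega : 0 < s.card)
        obtain ⟨y, hy⟩ := Finset.card_pos.mp (by rw [hΓcard γ0 hγ0]; omega : 0 < γ0.card)
        obtain ⟨g, hg, e⟩ := htrans y z
        have hgΓ := hinv g hg γ0 hγ0
        refine ⟨_, hgΓ, ?_⟩
        rw [← hΓcard _ hgΓ]
        apply Finset.card_lt_card
        rw [Finset.ssubset_iff_of_subset Finset.sdiff_subset]
        exact ⟨z, Finset.mem_image.mpr ⟨y, hy, e⟩, by simp [hz]⟩
      · rw [hsplit0, Multiset.countP_cons, Multiset.countP_eq_zero.mpr]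
        · split_ifs <;> omega
        · intro n hn
          rw [Multiset.eq_of_mem_replicate hn]
          simp
    by_cases hB2 : ∀ U ∈ P, U ≠ U0 → x U = a
    · -- type (2)
      have hrep : (P.erase U0).val.map x = Multiset.replicate (b - 1) a := by
        rw [Multiset.eq_replicate]
        refine ⟨by rw [Multiset.card_map, Finset.card_val, hcard0], ?_⟩
        intro n hn
        rw [Multiset.mem_map] at hn
        obtain ⟨U, hU, rfl⟩ := hn
        have hU' : U ∈ P.erase U0 := hU
        rw [Finset.mem_erase] at hU'
        exact hB2 U hU'.2 hU'.1
      rw [hrep] at hsplit0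
      have hpk : x U0 + (b - 1) * a = k := by
        rw [hsplit0] at htsum
        simpa using htsum
      have hba : (b - 1) * a + a = a * b := by
        obtain ⟨c, rfl⟩ := Nat.exists_eq_succ_of_ne_zero (by omega : b ≠ 0)
        simp only [Nat.succ_sub_one, Nat.succ_eq_add_one]
        ring
      have hz := hB2 Uo hUo hUo0
      have hpk' : x U0 = k - (a * b - a) := by omega
      have hcl := hclose Uo hUo U0 hU0 hUo0 (by omega) hpa' (by omega)
      rw [hpk'] at hsplit0
      refine ⟨Or.inr (Or.inl ⟨hsplit0, by omega⟩), ?_⟩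
      refine conn_co hP hΓcard ht hcl ?_ ?_
      · intro s hs
        have hc : ∀ r : Finset V, r.card = k → 0 < rᶜ.card := by
          intro r hr
          rw [Finset.card_compl, hr]
          omega
        obtain ⟨z, hz⟩ := Finset.card_pos.mp (hc s hs)
        obtain ⟨y, hy⟩ := Finset.card_pos.mp (hc γ0 (hΓcard γ0 hγ0))
        rw [Finset.mem_compl] at hz hy
        obtain ⟨g, hg, e⟩ := htrans y z
        have hgΓ := hinv g hg γ0 hγ0
        refine ⟨_, hgΓ, ?_⟩
        apply Finset.card_lt_card
        rw [Finset.ssubset_iff_of_subset]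
        · refine ⟨z, by simp [hz], ?_⟩
          intro h
          have h' := (Finset.mem_sdiff.mp h).1
          obtain ⟨y', hy', e'⟩ := Finset.mem_image.mp h'
          have : y' = y := g.injective (e'.trans e.symm)
          exact hy (this ▸ hy')
        · intro y' hy'
          simp only [Finset.mem_sdiff] at hy'
          simp [hy'.2]
      · rw [hsplit0, Multiset.countP_cons, Multiset.countP_eq_zero.mpr]
        · split_ifs <;> omega
        · intro n hn
          rw [Multiset.eq_of_mem_replicate hn]
          simp
    -- type (7)
    push Not at hB1 hB2
    obtain ⟨U1, hU1, hU10, hx1⟩ := hB1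
    obtain ⟨U2, hU2, hU20, hx2⟩ := hB2
    have hx1a : x U1 = a := by rcases hB U1 hU1 hU10 with h | h <;> tauto
    have hx2z : x U2 = 0 := by rcases hB U2 hU2 hU20 with h | h <;> tauto
    have hU12 : U1 ≠ U2 := by rintro rfl; omega
    have q := huniq U1 hU1 U2 hU2 hU12 (by omega) (by omega) (by omega)
    have q1 := q U0 hU0 U2 hU2 hU20.symm hp0' (by omega)
    have q2 := q U1 hU1 U0 hU0 hU10 (by omega) hpa'
    have hxU0 : x U0 = 1 := by omega
    have ha2 : a = 2 := by omega
    have hcl := hclose U1 hU1 U2 hU2 hU12 (by omega) (by omega) (by omega)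
    have hB' : ∀ n ∈ (P.erase U0).val.map x, n = 2 ∨ n = 0 := by
      intro n hn
      rw [Multiset.mem_map] at hn
      obtain ⟨U, hU, rfl⟩ := hn
      have hU' : U ∈ P.erase U0 := hU
      rw [Finset.mem_erase] at hU'
      have := hB U hU'.2 hU'.1
      omega
    obtain ⟨m, m', e⟩ := two_vals _ 2 0 hB'
    have hmm : m + m' = b - 1 := by
      rw [← hcard0]
      have := congrArg Multiset.card e
      rw [Multiset.card_map, Finset.card_val, Multiset.card_add, Multiset.card_replicate,
        Multiset.card_replicate] at this
      exact this.symm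
    rw [e, hxU0] at hsplit0
    have hmk : 1 + m * 2 = k := by
      rw [hsplit0] at htsum
      simpa using htsum
    have hb3 : 3 ≤ b := by
      rw [← hP.1]
      have : ({U0, U1, U2} : Finset (Finset V)) ⊆ P := by
        intro Z hZ
        simp only [Finset.mem_insert, Finset.mem_singleton] at hZ
        rcases hZ with rfl | rfl | rfl <;> assumption
      have h3 : ({U0, U1, U2} : Finset (Finset V)).card = 3 :=
        Finset.card_eq_three.mpr ⟨U0, U1, U2, hU10.symm, hU20.symm, hU12, rfl⟩
      rw [← h3]
      exact Finset.card_le_card this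
    have e1 : (k - 1) / 2 = m := by omega
    have e2 : b - (k + 1) / 2 = m' := by omega
    refine ⟨?_, ?_⟩
    · iterate 6 right
      refine ⟨?_, ⟨m, by omega⟩, ha2, hb3⟩
      rw [e1, e2]
      exact hsplit0
    · refine conn_seven hP hΓcard hne ht hcl ?_ ?_ ?_
      · intro n hn
        obtain ⟨U, hU, rfl⟩ := hmem n hn
        have := hxa U hU
        omega
      · rw [hsplit0]
        simp
      · rw [hsplit0, Multiset.countP_cons, Multiset.countP_eq_zero.mpr]
        · split_ifs <;> omega
        · intro n hn
          rw [← e] at hn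
          have := hB' n hn
          omega
  push Not at hB
  obtain ⟨U1, hU1, hU10, h1z, h1a⟩ := hB
  have h1z' : 0 < x U1 := Nat.pos_of_ne_zero h1z
  have h1a' : x U1 < a := lt_of_le_of_ne (hxa U1 hU1) h1a
  by_cases hC : x U1 = x U0
  · have q := huniq U0 hU0 U1 hU1 hU10.symm hp0' h1a' (by omega)
    have hcl := hclose U0 hU0 U1 hU1 hU10.symm hp0' h1a' (by omega)
    have hval : ∀ W ∈ P, x W = x U0 ∨ (x W = 0 ∧ x U0 = 1) ∨ (x W = a ∧ x U0 + 1 = a) := by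
      intro W hW
      by_cases hW0 : W = U0
      · left; rw [hW0]
      have r1 := q U0 hU0 W hW (Ne.symm hW0) hp0'
      have r2 := q W hW U0 hU0 hW0
      have := hxa W hW
      omega
    have hnot : ∀ W ∈ P, ∀ Z ∈ P, x W = 0 → x Z = a → False := by
      intro W hW Z hZ h1 h2
      have hne : Z ≠ W := by rintro rfl; omega
      have := q Z hZ W hW hne (by omega) (by omega)
      omega
    by_cases hz : x U0 = 1 ∧ ∀ W ∈ P, x W = 1 ∨ x W = 0
    · -- type (3)
      obtain ⟨m, m', hm, hmk, e⟩ := htwo 1 0 hz.2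
      have hmk' : m = k := by omega
      have hm' : m' = b - k := by omega
      refine ⟨?_, hfin2 0 (fun U hU => (hz.2 U hU).symm) hcl⟩
      right; right; left
      refine ⟨?_, by omega⟩
      rw [e, hmk', hm']
    by_cases hy : ∃ W ∈ P, x W = a
    · -- type (4)
      obtain ⟨Z, hZ, hZa⟩ := hy
      have hZ' := hval Z hZ
      have hpa1 : x U0 + 1 = a := by omega
      have hv2 : ∀ U ∈ P, x U = a - 1 ∨ x U = a := by
        intro U hU
        have := hval U hU
        have : x U ≠ 0 := fun h => hnot U hU Z hZ h hZa
        omega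
      obtain ⟨m, m', hm, hmk, e⟩ := htwo (a - 1) a hv2
      have hmv : m + k = a * b := by
        rw [← hm, ← hmk]
        obtain ⟨c, rfl⟩ := Nat.exists_eq_succ_of_ne_zero (by omega : a ≠ 0)
        simp only [Nat.succ_sub_one, Nat.succ_eq_add_one]
        ring
      refine ⟨?_, hfin2 (a - 1) (fun U hU => by have := hv2 U hU; omega) hcl⟩
      right; right; right; left
      refine ⟨?_, by omega⟩
      rw [e]
      congr 2 <;> omega
    · -- type (5)
      push Not at hy
      have hall : ∀ W ∈ P, x W = x U0 := by
        by_contra! hcon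
        obtain ⟨W, hW, hWne⟩ := hcon
        have h1 := hval W hW
        have h2 := hy W hW
        refine hz ⟨by omega, fun Z hZ => ?_⟩
        have h3 := hval Z hZ
        have h4 := hy Z hZ
        omega
      have hp1 : x U0 ≠ 1 := fun h => hz ⟨h, fun W hW => Or.inl (h ▸ hall W hW)⟩
      have e : t = Multiset.replicate b (x U0) := by
        rw [Multiset.eq_replicate]
        refine ⟨htcard, fun n hn => ?_⟩
        obtain ⟨U, hU, rfl⟩ := hmem n hn
        exact hall U hU
      refine ⟨?_, hfin2 (x U0) (fun U hU => Or.inl (hall U hU)) hcl⟩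
      right; right; right; right; left
      refine ⟨x U0, e, ?_, by omega, by omega⟩
      rw [e] at htsum
      rw [← htsum]
      simp [mul_comm]
  · -- type (6)
    have main : ∀ A ∈ P, ∀ B ∈ P, x A < x B → 0 < x A → x B < a →
        AdmissibleType a b (a * b) k t ∧ Γ = {s : Finset V | s.card = k ∧ utype P s = t} := by
      intro A hA B hB hlt h0 hBa
      have hAB : A ≠ B := by rintro rfl; omega
      have q := huniq A hA B hB hAB h0 hBa (by omega)
      have hcl := hclose A hA B hB hAB h0 hBa (by omega)
      have q1 := q B hB A hA hAB.symm (by omega) (by omega)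
      have hBA : x B = x A + 1 := by omega
      have hthird : ∀ C ∈ P, C = A ∨ C = B := by
        intro C hC
        by_contra! hcon
        have r1 := q C hC A hA hcon.1
        have r2 := q A hA C hC hcon.1.symm
        have r3 := q C hC B hB hcon.2
        have r4 := q B hB C hC hcon.2.symm
        have := hxa C hC
        omega
      have hPAB : P = {A, B} := by
        ext C
        simp only [Finset.mem_insert, Finset.mem_singleton]
        constructor
        · exact hthird C
        · rintro (rfl | rfl) <;> assumption
      have hb2 : b = 2 := by
        rw [← hP.1, hPAB, Finset.card_pair hAB]
      have e : t = x A ::ₘ x B ::ₘ 0 := by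
        rw [hxt, hPAB, Finset.insert_val_of_notMem (by simpa using hAB)]
        simp
      have hs : x A + x B = k := by
        rw [e] at htsum
        simpa using htsum
      refine ⟨?_, hfin2 (x A) (fun U hU => ?_) hcl⟩
      · right; right; right; right; right; left
        refine ⟨?_, ⟨x A, by omega⟩, by omega, hb2⟩
        rw [e]
        congr 2 <;> omega
      · rcases hthird U hU with rfl | rfl <;> omega
    rcases lt_or_gt_of_ne hC with h | h
    · exact main U1 hU1 U0 hU0 h h1z' hpa'
    · exact main U0 hU0 U1 hU1 h hp0' h1a'
end

section
/- Suppose Γ is a nonempty set of k-element subsets of 𝒱, G ≤ Sym(𝒱) leaves Γ invariant, and Γ is G-strongly incidence-transitive. Let γ ∈ Γ and suppose G_γ ≤ H ≤ G, where H is transitive on 𝒱 and H leaves invariant a partition Π of 𝒱 each of whose parts is a proper subset of 𝒱. Then γ is a union of parts of Π. -/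
variable {α : Type*} [DecidableEq α]

/-- Lemma `obs`: if `Γ` is `G`-strongly incidence-transitive,
`γ ∈ Γ`, and `G_γ ≤ H ≤ G` with `H` transitive on the points and leaving invariant a
partition `P` of the points into proper subsets, then `γ` is a union of parts of `P`. -/
theorem stmt12 {V : Type*} [Fintype V] [DecidableEq V] (k : ℕ)
    (Γ : Set (Finset V)) (hΓcard : ∀ γ ∈ Γ, γ.card = k) (hne : Γ.Nonempty)
    (G H : Subgroup (Equiv.Perm V)) (hinv : Invariant (G : Set (Equiv.Perm V)) Γ)
    (hstr : StrIncTrans (G : Set (Equiv.Perm V)) Γ)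
    (γ : Finset V) (hγ : γ ∈ Γ)
    (hHG : H ≤ G) (hGγH : ∀ g ∈ G, pact g γ = γ → g ∈ H)
    (hHtrans : ∀ x y : V, ∃ h ∈ H, h x = y)
    (P : Finset (Finset V))
    (hPdisj : ∀ π ∈ P, ∀ π' ∈ P, π ≠ π' → Disjoint π π')
    (hPcover : P.biUnion id = Finset.univ)
    (hPne : ∀ π ∈ P, π.Nonempty)
    (hPproper : ∀ π ∈ P, π ≠ Finset.univ)
    (hPinv : ∀ h ∈ H, ∀ π ∈ P, pact h π ∈ P) :
    ∃ S ⊆ P, γ = S.biUnion id := by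
  classical
  have key : ∀ π ∈ P, ∀ u ∈ π, u ∈ γ → π ⊆ γ := by
    intro π hπ u huπ huγ w hwπ
    by_contra hwγ
    have same : ∀ u' ∈ γ, ∀ w' ∉ γ, ∃ ρ ∈ P, u' ∈ ρ ∧ w' ∈ ρ := by
      intro u' hu' w' hw'
      obtain ⟨g, hg, hgγ, hgu, hgw⟩ := hstr.2 γ hγ u huγ w hwγ u' hu' w' hw'
      refine ⟨pact g π, hPinv g (hGγH g hg hgγ) π hπ, ?_, ?_⟩
      · exact hgu ▸ Finset.mem_image_of_mem g huπ
      · exact hgw ▸ Finset.mem_image_of_mem g hwπ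
    have uniq : ∀ ρ ∈ P, ∀ x ∈ ρ, x ∈ π → ρ = π := by
      intro ρ hρ x hxρ hxπ
      by_contra hne'
      exact Finset.disjoint_left.mp (hPdisj ρ hρ π hπ hne') hxρ hxπ
    apply hPproper π hπ
    apply Finset.eq_univ_iff_forall.mpr
    intro x
    by_cases hx : x ∈ γ
    · obtain ⟨ρ, hρ, h1, h2⟩ := same x hx w hwγ
      exact uniq ρ hρ w h2 hwπ ▸ h1
    · obtain ⟨ρ, hρ, h1, h2⟩ := same u huγ x hx
      exact uniq ρ hρ u h1 huπ ▸ h2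
  refine ⟨P.filter (fun π => π ⊆ γ), Finset.filter_subset _ _, ?_⟩
  ext x
  simp only [Finset.mem_biUnion, Finset.mem_filter, id]
  constructor
  · intro hx
    have hc : x ∈ P.biUnion id := hPcover ▸ Finset.mem_univ x
    obtain ⟨π, hπ, hxπ⟩ := Finset.mem_biUnion.mp hc
    exact ⟨π, ⟨hπ, key π hπ x hxπ hx⟩, hxπ⟩
  · rintro ⟨π, ⟨_, hs⟩, hxπ⟩
    exact hs hxπ
end

section
/- Let F be a finite field with q = p^a elements (p prime) and suppose N ≤ G ≤ AΓL(1,q), where N is the group of translations. Let γ ⊆ F with |γ| = k and 1 ≤ k ≤ q−1, and suppose the setwise stabiliser G_γ is transitive on γ × (F ∖ γ). Then one of the following holds: (i) k = 1 or k = q−1; (ii) q = 4 and k = 2; (iii) q = 16, k = 4 or k = 12, and γ or its complement F ∖ γ has the form u·K + w = { u·s + w : s ∈ K }, where K is the subfield of F of order 4, u ∈ Fˣ and w ∈ F. Moreover, in case (iii) any two distinct subsets of F of the form u·K + w (u ∈ Fˣ, w ∈ F) intersect in at most one point. -/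
open Finset in
/-- Semilinear transitivity of the stabiliser of `s` on `s × sᶜ`. -/
def SLTrans {F : Type*} [Field F] (s : Finset F) : Prop :=
  ∀ u ∈ s, ∀ w ∉ s, ∀ u' ∈ s, ∀ w' ∉ s,
    ∃ (c d : F) (φ : F ≃+* F), c ≠ 0 ∧ (∀ x, c * φ x + d ∈ s ↔ x ∈ s) ∧
      c * φ u + d = u' ∧ c * φ w + d = w'

/-- `e` is the multiplier of a homothety with centre `x` preserving `s`. -/
def Hom1 {F : Type*} [Field F] (s : Finset F) (x e : F) : Prop :=
  e ≠ 0 ∧ ∀ y, e * (y - x) + x ∈ s ↔ y ∈ s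

theorem SLTrans.compl {F : Type*} [Field F] [Fintype F] [DecidableEq F] {s : Finset F}
    (h : SLTrans s) : SLTrans sᶜ := by
  intro u hu w hw u' hu' w' hw'
  simp only [Finset.mem_compl, not_not] at hu hw hu' hw'
  obtain ⟨c, d, φ, hc, h1, h2, h3⟩ := h w hw u hu w' hw' u' hu'
  exact ⟨c, d, φ, hc, fun x => by simp [h1], h3, h2⟩

theorem card_aut_le {F : Type*} [Field F] [Fintype F] (p a : ℕ) (hp : p.Prime)
    (hcard : Fintype.card F = p ^ a) [Fintype (F ≃+* F)] : Fintype.card (F ≃+* F) ≤ a := by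
  classical
  haveI : Fact p.Prime := ⟨hp⟩
  haveI : CharP F p := charP_of_card_eq_prime_pow hcard
  letI : Algebra (ZMod p) F := ZMod.algebra F p
  have h1 : Module.finrank (ZMod p) F = a := by
    have := Module.card_eq_pow_finrank (K := ZMod p) (V := F)
    rw [hcard, ZMod.card] at this
    exact (Nat.pow_right_injective hp.two_le this).symm
  have h2 : Fintype.card (F ≃ₐ[ZMod p] F) ≤ a := h1 ▸ AlgEquiv.card_le
  refine le_trans (Fintype.card_le_of_injective
    (fun φ : F ≃+* F => (AlgEquiv.ofRingEquiv (f := φ) (fun x => by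
      have : (φ : F →+* F).comp (algebraMap (ZMod p) F) = algebraMap (ZMod p) F :=
        Subsingleton.elim _ _
      exact congrArg (fun f => f x) this) : F ≃ₐ[ZMod p] F)) ?_) h2
  intro φ ψ h
  ext x
  exact congrArg (fun f : F ≃ₐ[ZMod p] F => f x) h

open Classical in
theorem sl_compl_le {F : Type*} [Field F] [Fintype F] (p a : ℕ) (hp : p.Prime)
    (hcard : Fintype.card F = p ^ a) {s : Finset F} (h : SLTrans s) {x : F} (hx : x ∈ s) :
    sᶜ.card ≤ (Finset.univ.filter (fun e => Hom1 s x e)).card * a := by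
  letI : Fintype (F ≃+* F) := Fintype.ofInjective (fun φ : F ≃+* F => (φ : F → F))
    DFunLike.coe_injective
  rcases sᶜ.eq_empty_or_nonempty with h0 | ⟨w0, hw0⟩
  · simp [h0]
  rw [Finset.mem_compl] at hw0
  have h' : ∀ w, ∃ (c : F) (φ : F ≃+* F), w ∉ s → c ≠ 0 ∧
      (∀ y, c * φ (y - x) + x ∈ s ↔ y ∈ s) ∧ c * φ (w0 - x) + x = w := by
    intro w
    by_cases hw : w ∈ s
    · exact ⟨1, RingEquiv.refl F, fun h => absurd hw h⟩
    obtain ⟨c, d, φ, hc, h1, h2, h3⟩ := h x hx w0 hw0 x hx w hw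
    have key : ∀ y, c * φ (y - x) + x = c * φ y + d := by
      intro y
      rw [map_sub]
      linear_combination -h2
    exact ⟨c, φ, fun _ => ⟨hc, fun y => by rw [key, h1], by rw [key, h3]⟩⟩
  choose c φ hc using h'
  refine le_trans (Finset.card_le_mul_card_image_of_maps_to (f := φ) (s := sᶜ)
    (t := Finset.univ) (fun _ _ => Finset.mem_univ _)
    (Finset.univ.filter (fun e => Hom1 s x e)).card ?_)
    (Nat.mul_le_mul_left _ (by rw [Finset.card_univ]; exact card_aut_le p a hp hcard))
  intro ψ _
  rcases (sᶜ.filter (fun w => φ w = ψ)).eq_empty_or_nonempty with h0 | ⟨w1, hw1⟩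
  · simp [h0]
  simp only [Finset.mem_filter, Finset.mem_compl] at hw1
  obtain ⟨hw1, rfl⟩ := hw1
  obtain ⟨hc1, hs1, he1⟩ := hc w1 hw1
  refine Finset.card_le_card_of_injOn (fun w => c w / c w1) ?_ ?_
  · intro w hw
    simp only [Finset.coe_filter, Finset.mem_compl, Set.mem_setOf_eq] at hw
    obtain ⟨hw, hφ⟩ := hw
    obtain ⟨hc2, hs2, he2⟩ := hc w hw
    simp only [Finset.coe_filter, Finset.mem_univ, true_and, Set.mem_setOf_eq]
    refine ⟨div_ne_zero hc2 hc1, fun y => ?_⟩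
    rw [hφ] at hs2
    have e1 := hs1 ((φ w1).symm ((y - x) / c w1) + x)
    have e2 := hs2 ((φ w1).symm ((y - x) / c w1) + x)
    simp only [add_sub_cancel_right, RingEquiv.apply_symm_apply] at e1 e2
    rw [← e1] at e2
    rw [show c w / c w1 * (y - x) = c w * ((y - x) / c w1) by ring, e2,
      mul_div_cancel₀ _ hc1, sub_add_cancel]
  · intro w hw w' hw' hww
    simp only [Finset.coe_filter, Finset.mem_compl, Set.mem_setOf_eq] at hw hw'
    have e := (hc w hw.1).2.2
    have e' := (hc w' hw'.1).2.2
    have : c w = c w' := by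
      simp only at hww
      field_simp at hww
      exact hww
    rw [← e, ← e', this, hw.2, hw'.2]

theorem Hom1.pow {F : Type*} [Field F] {s : Finset F} {x e : F} (h : Hom1 s x e) (n : ℕ) :
    Hom1 s x (e ^ n) := by
  induction n with
  | zero => exact ⟨by simp, by simp⟩
  | succ n ih =>
    refine ⟨pow_ne_zero _ h.1, fun y => ?_⟩
    have := ih.2 (e * (y - x) + x)
    rw [add_sub_cancel_right, ← mul_assoc, h.2] at this
    rw [pow_succ, this]

theorem Hom1.transfer {F : Type*} [Field F] [Fintype F] {s : Finset F} (hs : SLTrans s)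
    {w : F} (hw : w ∉ s) {x x' e : F} (hx : x ∈ s) (hx' : x' ∈ s)
    (h : Hom1 s x e) : Hom1 s x' e := by
  obtain ⟨c, d, φ, hc, h1, h2, -⟩ := hs x hx w hw x' hx' w hw
  have h3 : Hom1 s x' (φ e) := by
    refine ⟨by simpa using h.1, fun y => ?_⟩
    obtain ⟨z, rfl⟩ : ∃ z, y = c * φ z + d :=
      ⟨φ.symm ((y - d) / c), by rw [RingEquiv.apply_symm_apply]; field_simp; ring⟩
    rw [h1, ← h.2 z, ← h1 (e * (z - x) + x)]
    have : φ e * (c * φ z + d - x') + x' = c * φ (e * (z - x) + x) + d := by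
      rw [← h2]; simp only [map_add, map_mul, map_sub]; ring
    rw [this]
  have hpos : 0 < orderOf (φ e) := by
    rw [orderOf_pos_iff, isOfFinOrder_iff_pow_eq_one]
    exact ⟨Fintype.card F - 1, by have := Fintype.one_lt_card (α := F); omega,
      FiniteField.pow_card_sub_one_eq_one _ h3.1⟩
  haveI : NeZero (orderOf (φ e)) := ⟨hpos.ne'⟩
  have h4 : e ^ orderOf (φ e) = 1 := by
    apply φ.injective
    rw [map_pow, pow_orderOf_eq_one, map_one]
  obtain ⟨i, -, hi⟩ := (IsPrimitiveRoot.orderOf (φ e)).eq_pow_of_pow_eq_one h4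
  rw [← hi]
  exact h3.pow i

theorem arith_aux (p a d m n : ℕ) (hp : p.Prime) (hn : 1 ≤ n) (hnm : n < m) (hd : 1 ≤ d)
    (ha : a = d * m) (h : (p ^ d) ^ m - (p ^ d) ^ n ≤ (p ^ d - 1) * a) :
    (p = 2 ∧ d = 1 ∧ m = 2) ∨ (p = 2 ∧ d = 2 ∧ m = 2) := by
  have hs : 2 ≤ p ^ d := le_trans hp.two_le (Nat.le_self_pow (by omega) p)
  obtain ⟨r, rfl⟩ : ∃ r, m = r + 1 := ⟨m - 1, by omega⟩
  have h1 : (p ^ d) ^ n ≤ (p ^ d) ^ r := Nat.pow_le_pow_right (by omega) (by omega)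
  have h2 : (p ^ d) ^ r * (p ^ d - 1) ≤ a * (p ^ d - 1) := by
    rw [Nat.mul_sub, ← pow_succ, mul_one, mul_comm a]
    omega
  have h3 : (p ^ d) ^ r ≤ a := Nat.le_of_mul_le_mul_right h2 (by omega)
  rw [← pow_mul] at h3
  have hr : 1 ≤ r := by omega
  have hdr : d ≤ d * r := Nat.le_mul_of_pos_right _ hr
  have ha2 : a = d * r + d := by rw [ha]; ring
  have hpow : 2 ^ (d * r) ≤ p ^ (d * r) := Nat.pow_le_pow_left hp.two_le _
  have he : d * r ≤ 2 := by
    by_contra hcon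
    have : ∀ e, 3 ≤ e → 2 * e < 2 ^ e := by
      intro e he
      induction e, he using Nat.le_induction with
      | base => norm_num
      | succ e he ih => rw [pow_succ]; omega
    have := this (d * r) (by omega)
    omega
  have hd2 : d ≤ 2 := by omega
  have hr2 : r ≤ 2 := le_trans (Nat.le_mul_of_pos_left _ hd) he
  have := hp.two_le
  subst ha
  interval_cases d <;> interval_cases r <;> simp at h3 he ha2 ⊢
  · omega
  · nlinarith
  · nlinarith

/-- The additive stabiliser. -/
def tstab {F : Type*} [Field F] (s : Finset F) : AddSubgroup F where
  carrier := {t | ∀ y, y + t ∈ s ↔ y ∈ s}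
  zero_mem' := by simp
  add_mem' := by
    intro t t' h h' y
    rw [← add_assoc, h', h]
  neg_mem' := by
    intro t h y
    rw [← h (y + -t)]
    simp

/-- The subfield of multipliers of an additive subgroup. -/
def mulField {F : Type*} [Field F] [Fintype F] (T : AddSubgroup F) : Subfield F where
  carrier := {x | ∀ t ∈ T, x * t ∈ T}
  zero_mem' := by intro t _; rw [zero_mul]; exact T.zero_mem
  one_mem' := by intro t h; rwa [one_mul]
  add_mem' := by intro x y hx hy t ht; rw [add_mul]; exact T.add_mem (hx t ht) (hy t ht)
  mul_mem' := by intro x y hx hy t ht; rw [mul_assoc]; exact hx _ (hy _ ht)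
  neg_mem' := by intro x hx t ht; rw [neg_mul]; exact T.neg_mem (hx t ht)
  inv_mem' := by
    intro x hx
    by_cases h0 : x = 0
    · subst h0; simpa using hx
    have hpow : ∀ n : ℕ, ∀ t ∈ T, x ^ n * t ∈ T := by
      intro n
      induction n with
      | zero => simp
      | succ n ih => intro t ht; rw [pow_succ, mul_assoc]; exact ih _ (hx t ht)
    have : x⁻¹ = x ^ (Fintype.card F - 2) := by
      rw [inv_eq_iff_eq_inv, eq_comm, inv_eq_iff_eq_inv]
      apply eq_inv_of_mul_eq_one_left
      rw [← pow_succ, ← FiniteField.pow_card_sub_one_eq_one x h0]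
      congr 1
      have := Fintype.one_lt_card (α := F)
      omega
    rw [this]
    exact hpow _

open Classical in
theorem main_aux {F : Type*} [Field F] [Fintype F] (p a : ℕ) (hp : p.Prime)
    (hcard : Fintype.card F = p ^ a) {s : Finset F} (hs : SLTrans s) (h2 : 2 ≤ s.card)
    {w : F} (hw : w ∉ s) {x e : F} (hx : x ∈ s) (he : Hom1 s x e) (he1 : e ≠ 1) :
    p ^ a = 4 ∨ (p ^ a = 16 ∧ s.card = 4 ∧ ∃ K : Subfield F, Nat.card K = 4 ∧
      ∃ u w : F, u ≠ 0 ∧ (s : Set F) = (fun s => u * s + w) '' (K : Set F)) := by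
  -- translations
  have hT : ∀ x' ∈ s, (1 - e) * (x' - x) ∈ tstab s := by
    intro x' hx' y
    have h1 := he.transfer hs hw hx hx'
    have e1 := he.2 ((y - x) / e + x)
    have e2 := h1.2 ((y - x) / e + x)
    have hne := he.1
    rw [← e1] at e2
    rw [add_sub_cancel_right, mul_div_cancel₀ _ hne, sub_add_cancel] at e2
    rw [← e2]
    have : y + (1 - e) * (x' - x) = e * ((y - x) / e + x - x') + x' := by
      field_simp; ring
    rw [this]
  set T := tstab s with hTdef
  have hTx : ∀ t ∈ T, t + x ∈ s := fun t ht => by rw [add_comm]; exact (ht x).2 hx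
  have he1' : (1 - e) ≠ 0 := sub_ne_zero.2 (Ne.symm he1)
  -- `s = T + x`
  have himg : s = (Finset.univ.filter (fun t => t ∈ T)).image (fun t => t + x) := by
    symm
    apply Finset.eq_of_subset_of_card_le
    · intro y hy
      simp only [Finset.mem_image, Finset.mem_filter, Finset.mem_univ, true_and] at hy
      obtain ⟨t, ht, rfl⟩ := hy
      exact hTx t ht
    · rw [Finset.card_image_of_injective _ (add_left_injective x)]
      refine Finset.card_le_card_of_injOn (fun x' => (1 - e) * (x' - x)) ?_ ?_
      · intro x' hx'
        simpa using hT x' hx'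
      · intro y _ z _ hyz
        have := mul_left_cancel₀ he1' hyz
        exact sub_left_injective this
  have hmem : ∀ y, y ∈ s ↔ y - x ∈ T := by
    intro y
    constructor
    · intro hy
      rw [himg] at hy
      simp only [Finset.mem_image, Finset.mem_filter, Finset.mem_univ, true_and] at hy
      obtain ⟨t, ht, rfl⟩ := hy
      simpa using ht
    · intro hy
      simpa using hTx _ hy
  have hcT : s.card = Fintype.card T := by
    rw [himg, Finset.card_image_of_injective _ (add_left_injective x), Fintype.card_subtype]
  let K := mulField T
  have hKT : ∀ c ∈ K, ∀ t ∈ T, c * t ∈ T := fun c hc t ht => hc t ht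
  have hHK : ∀ c, Hom1 s x c → c ∈ K := by
    intro c hc t ht
    have := (hc.2 (t + x)).2 (hTx t ht)
    rw [hmem] at this
    simpa using this
  have hfil : (Finset.univ.filter (fun e => Hom1 s x e)).card ≤ Fintype.card K - 1 := by
    have h1 : (Finset.univ.filter (fun e => Hom1 s x e)) ⊆
        (Finset.univ.filter (fun c => c ∈ K)).erase 0 := by
      intro c hc
      simp only [Finset.mem_filter, Finset.mem_univ, true_and] at hc
      simp only [Finset.mem_erase, Finset.mem_filter, Finset.mem_univ, true_and]
      exact ⟨hc.1, hHK c hc⟩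
    have h2 := Finset.card_le_card h1
    rw [Finset.card_erase_of_mem (by simpa using K.zero_mem)] at h2
    rwa [Fintype.card_subtype]
  let TK : Submodule K F :=
    { carrier := T
      zero_mem' := T.zero_mem
      add_mem' := T.add_mem
      smul_mem' := fun c t ht => hKT c c.2 t ht }
  have hcT' : Fintype.card TK = s.card := by rw [hcT]; exact Fintype.card_congr (Equiv.refl _)
  have hq : Fintype.card F = Fintype.card K ^ Module.finrank K F :=
    Module.card_eq_pow_finrank
  have hk : Fintype.card TK = Fintype.card K ^ Module.finrank K TK :=
    Module.card_eq_pow_finrank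
  rw [hcT'] at hk
  set m := Module.finrank K F with hm
  set n := Module.finrank K TK with hn
  have hKge : 2 ≤ Fintype.card K := Fintype.one_lt_card
  have hm0 : 1 ≤ m := Nat.one_le_iff_ne_zero.2 (by
    intro h0
    rw [h0, pow_zero] at hq
    have := Fintype.one_lt_card (α := F)
    omega)
  have hn0 : 1 ≤ n := Nat.one_le_iff_ne_zero.2 (by
    intro h0
    rw [h0, pow_zero] at hk
    omega)
  have hlt : s.card < Fintype.card F := by
    rw [← Finset.card_univ]
    exact Finset.card_lt_card (Finset.ssubset_univ_iff.2 (fun h => hw (h ▸ Finset.mem_univ w)))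
  have hnm : n < m := by
    rw [hk, hq] at hlt
    exact (Nat.pow_lt_pow_iff_right hKge).1 hlt
  obtain ⟨d, -, hd⟩ := (Nat.dvd_prime_pow hp).1
    (show Fintype.card K ∣ p ^ a by rw [← hcard, hq]; exact dvd_pow_self _ (by omega))
  have hd0 : 1 ≤ d := Nat.one_le_iff_ne_zero.2 (by
    intro h0
    rw [h0, pow_zero] at hd
    omega)
  have hadm : a = d * m := by
    rw [hcard, hd, ← pow_mul] at hq
    exact Nat.pow_right_injective hp.two_le hq
  have hle := sl_compl_le p a hp hcard hs hx
  rw [Finset.card_compl] at hle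
  have hle' := hle.trans (Nat.mul_le_mul_right a hfil)
  rw [hq, hk, hd] at hle'
  rcases arith_aux p a d m n hp hn0 hnm hd0 hadm hle' with ⟨h1, h2', h3⟩ | ⟨h1, h2', h3⟩
  · left; rw [hadm, h1, h2', h3]; norm_num
  · right
    have hn1 : n = 1 := by omega
    have hK4 : Fintype.card K = 4 := by rw [hd, h1, h2']; norm_num
    have hs4 : s.card = 4 := by rw [hk, hn1, hK4]; norm_num
    refine ⟨by rw [hadm, h1, h2', h3]; norm_num, hs4, K, by rw [Nat.card_eq_fintype_card, hK4], ?_⟩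
    obtain ⟨z, hz, hzx⟩ := Finset.exists_mem_ne (show 1 < s.card by omega) x
    have hu : z - x ≠ 0 := sub_ne_zero.2 hzx
    refine ⟨z - x, x, hu, ?_⟩
    have : s = (Finset.univ.filter (fun c => c ∈ K)).image (fun c => (z - x) * c + x) := by
      symm
      apply Finset.eq_of_subset_of_card_le
      · intro y hy
        simp only [Finset.mem_image, Finset.mem_filter, Finset.mem_univ, true_and] at hy
        obtain ⟨c, hc, rfl⟩ := hy
        rw [mul_comm]
        exact hTx _ (hKT c hc _ ((hmem z).1 hz))
      · rw [Finset.card_image_of_injective, ← Fintype.card_subtype, hs4]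
        · exact hK4.ge
        · intro c c' hcc
          exact mul_left_cancel₀ hu (add_right_cancel hcc)
    conv_lhs => rw [this]
    ext y
    simp

theorem img_eq {F : Type*} [Field F] (K : Subfield F) {u w P Q : F}
    (hPQ : P ≠ Q) (hP : P ∈ (fun s => u * s + w) '' (K : Set F))
    (hQ : Q ∈ (fun s => u * s + w) '' (K : Set F)) :
    (fun s => u * s + w) '' (K : Set F) = (fun s => (Q - P) * s + P) '' (K : Set F) := by
  obtain ⟨s, hs, rfl⟩ := hP
  obtain ⟨t, ht, rfl⟩ := hQ
  have hst : t - s ≠ 0 := by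
    intro h
    apply hPQ
    rw [sub_eq_zero.1 h]
  simp only [SetLike.mem_coe] at hs ht
  ext y
  simp only [Set.mem_image, SetLike.mem_coe]
  constructor
  · rintro ⟨r, hr, rfl⟩
    refine ⟨(r - s) / (t - s), K.div_mem (K.sub_mem hr hs) (K.sub_mem ht hs), ?_⟩
    field_simp
    ring
  · rintro ⟨r, hr, rfl⟩
    exact ⟨(t - s) * r + s, K.add_mem (K.mul_mem (K.sub_mem ht hs) hr) hs, by ring⟩

theorem img_inter {F : Type*} [Field F] (K : Subfield F) (u₁ w₁ u₂ w₂ : F)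
    (h : (fun s => u₁ * s + w₁) '' (K : Set F) ≠ (fun s => u₂ * s + w₂) '' (K : Set F)) :
    Set.Subsingleton (((fun s => u₁ * s + w₁) '' (K : Set F)) ∩
      ((fun s => u₂ * s + w₂) '' (K : Set F))) := by
  intro P hP Q hQ
  by_contra hPQ
  exact h ((img_eq K hPQ hP.1 hQ.1).trans (img_eq K hPQ hP.2 hQ.2).symm)

theorem card_triv {F : Type*} [Field F] [Fintype F] [DecidableEq F] (p a : ℕ) (hp : p.Prime)
    (hcard : Fintype.card F = p ^ a) {s : Finset F} (h : SLTrans s) {x : F} (hx : x ∈ s)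
    (ht : ∀ e, Hom1 s x e → e = 1) : sᶜ.card ≤ a := by
  classical
  have h1 := sl_compl_le p a hp hcard h hx
  have h2 : (Finset.univ.filter (fun e => Hom1 s x e)).card ≤ 1 := by
    rw [Finset.card_le_one]
    intro b hb c hc
    simp only [Finset.mem_filter, Finset.mem_univ, true_and] at hb hc
    rw [ht b hb, ht c hc]
  have h3 := h1.trans (Nat.mul_le_mul_right a h2)
  rw [one_mul] at h3
  refine le_trans (le_of_eq ?_) h3
  congr!


variable {α : Type*} [DecidableEq α]

/-- Proposition `aff1`: one-dimensional affine case. -/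
theorem stmt13 {F : Type*} [Field F] [Fintype F] [DecidableEq F] (p a q k : ℕ)
    (hp : p.Prime) (ha : 1 ≤ a) (hq : q = p ^ a) (hcard : Fintype.card F = q)
    (G : Subgroup (Equiv.Perm F))
    -- G ≤ AΓL(1,q)
    (hGup : ∀ g ∈ G, ∃ (u w : F) (φ : F ≃+* F), u ≠ 0 ∧ ∀ x, g x = u * φ x + w)
    -- N ≤ G, where N is the group of translations
    (hGlow : ∀ w : F, ∃ g ∈ G, ∀ x, g x = x + w)
    (γ : Finset F) (hγk : γ.card = k) (hk1 : 1 ≤ k) (hkq : k ≤ q - 1)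
    -- G_γ is transitive on γ × (F ∖ γ)
    (htrans : ∀ u ∈ γ, ∀ w ∉ γ, ∀ u' ∈ γ, ∀ w' ∉ γ,
        ∃ g ∈ G, pact g γ = γ ∧ g u = u' ∧ g w = w') :
    k = 1 ∨ k = q - 1 ∨ (q = 4 ∧ k = 2) ∨
    (q = 16 ∧ (k = 4 ∨ k = 12) ∧
      ∃ K : Subfield F, Nat.card ↥K = 4 ∧
        (∃ u w : F, u ≠ 0 ∧
          ((γ : Set F) = (fun s => u * s + w) '' (K : Set F) ∨
           (γ : Set F)ᶜ = (fun s => u * s + w) '' (K : Set F))) ∧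
        (∀ u₁ w₁ u₂ w₂ : F, u₁ ≠ 0 → u₂ ≠ 0 →
          (fun s => u₁ * s + w₁) '' (K : Set F) ≠ (fun s => u₂ * s + w₂) '' (K : Set F) →
          Set.Subsingleton
            (((fun s => u₁ * s + w₁) '' (K : Set F)) ∩
             ((fun s => u₂ * s + w₂) '' (K : Set F))))) := by


  have hSL : SLTrans γ := by
    intro u hu w hw u' hu' w' hw'
    obtain ⟨g, hg, h1, h2, h3⟩ := htrans u hu w hw u' hu' w' hw'
    obtain ⟨c, d, φ, hc, hgx⟩ := hGup g hg
    refine ⟨c, d, φ, hc, fun x => ?_, by rw [← hgx, h2], by rw [← hgx, h3]⟩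
    rw [← hgx]
    conv_lhs => rw [← h1]
    simp [pact]
  have hcard' : Fintype.card F = p ^ a := hcard.trans hq
  have hcc : γᶜ.card = q - k := by rw [Finset.card_compl, hcard, hγk]
  have hq2 : 2 ≤ q := by rw [← hcard]; exact Fintype.one_lt_card
  by_cases hk1' : k = 1
  · exact Or.inl hk1'
  by_cases hkq' : k = q - 1
  · exact Or.inr (Or.inl hkq')
  right; right
  have h4 : p ^ a = 4 → (q = 4 ∧ k = 2) := fun h => by omega
  obtain ⟨x, hx⟩ := Finset.card_pos.1 (show 0 < γ.card by omega)
  obtain ⟨w, hw⟩ := Finset.card_pos.1 (show 0 < γᶜ.card by omega)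
  have hwγ : w ∉ γ := by simpa using hw
  by_cases hA : ∀ e, Hom1 γ x e → e = 1
  · by_cases hB : ∀ e, Hom1 γᶜ w e → e = 1
    · have e1 := card_triv p a hp hcard' hSL hx hA
      have e2 := card_triv p a hp hcard' hSL.compl hw hB
      rw [compl_compl] at e2
      have e3 : 2 ^ a ≤ p ^ a := Nat.pow_le_pow_left hp.two_le a
      have ha2 : a ≤ 2 := by
        by_contra hcon
        have : ∀ e, 3 ≤ e → 2 * e < 2 ^ e := by
          intro e he
          induction e, he using Nat.le_induction with
          | base => norm_num
          | succ e he ih => rw [pow_succ]; omega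
        have := this a (by omega)
        omega
      left
      omega
    · push Not at hB
      obtain ⟨e, he, he1⟩ := hB
      rcases main_aux p a hp hcard' hSL.compl (by omega) (w := x) (by simpa using hx) hw he he1
        with h | ⟨h16, hs, K, hK, u, v, hu, huv⟩
      · exact Or.inl (h4 h)
      · refine Or.inr ⟨by omega, by omega, K, hK, ⟨u, v, hu, Or.inr ?_⟩,
          fun u₁ w₁ u₂ w₂ _ _ h => img_inter K u₁ w₁ u₂ w₂ h⟩
        rw [← huv, Finset.coe_compl]
  · push Not at hA
    obtain ⟨e, he, he1⟩ := hA
    rcases main_aux p a hp hcard' hSL (by omega) hwγ hx he he1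
      with h | ⟨h16, hs, K, hK, u, v, hu, huv⟩
    · exact Or.inl (h4 h)
    · exact Or.inr ⟨by omega, by omega, K, hK, ⟨u, v, hu, Or.inl huv⟩,
        fun u₁ w₁ u₂ w₂ _ _ h => img_inter K u₁ w₁ u₂ w₂ h⟩
end
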